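/- Let n ≥ 2, β ≥ 0, 0 ≤ ε < 1, C₀ > 1 and let χ be a cutoff. Assume α satisfies one of: (i) (n−3)/2 + ε < β < (n−1)/2 and α ≤ 2β − (n−3)/2 − ε; or (ii) β ≥ (n−1)/2 and α < β + 1 − ε. Then there exist a constant C > 0 and a real number λ with 0 < λ < 1 (possibly depending on β) such that for every θ ∈ S^{n−1}, every r > 0 and all Schwartz functions f₁, f₂ on ℝⁿ, ‖ k^ε · χ · K_r(𝓕f₁, 𝓕f₂) ‖_{L²_α} ≤ C (1+r)^λ ‖f₁‖_{W^{β,2}_1} ‖f₂‖_{W^{β,2}_1}, where (k^ε · χ · K_r(𝓕f₁,𝓕f₂))(η) := k(η,θ)^ε χ(η) K_r(𝓕f₁,𝓕f₂)(η) for η ∈ H_θ and := 0 for η ∉ H_θ. -/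

import Mathlib

open MeasureTheory Real Filter Set Metric
open scoped FourierTransform RealInnerProductSpace SchwartzMap ENNReal

noncomputable section

abbrev En (n : ℕ) := EuclideanSpace ℝ (Fin n)

/-- Japanese bracket `⟨x⟩ = (1+|x|²)^{1/2}`. -/
def jap {n : ℕ} (x : En n) : ℝ := Real.sqrt (1 + ‖x‖ ^ 2)

/-- `k(η,θ) = -|η|²/(θ·η)`. -/
def kval {n : ℕ} (θ η : En n) : ℝ := -‖η‖ ^ 2 / ⟪θ, η⟫

/-- The Ewald sphere `Γ_r(-2kθ)`, of center `-kθ` and radius `rk`. -/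
def ewald {n : ℕ} (θ η : En n) (r : ℝ) : Set (En n) :=
  Metric.sphere (-(kval θ η • θ)) (r * kval θ η)

/-- The spherical operator `S_{θ,r}`. -/
def Sop {n : ℕ} (θ : En n) (r : ℝ) (q : En n → ℂ) (η : En n) : ℂ :=
  if ⟪η, θ⟫ < 0 then
    ((kval θ η * (r + 1))⁻¹ : ℝ) •
      ∫ ξ in ewald θ η r, 𝓕 q ξ * 𝓕 q (η - ξ) ∂μH[(n : ℝ) - 1]
  else 0

/-- The operator `K_r(g₁,g₂)`. -/
def Kop {n : ℕ} {G₁ G₂ : Type*} [NormedAddCommGroup G₁] [NormedAddCommGroup G₂]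
    (θ : En n) (r : ℝ) (g₁ : En n → G₁) (g₂ : En n → G₂) (η : En n) : ℝ :=
  if ⟪η, θ⟫ < 0 then
    (kval θ η)⁻¹ * ∫ ξ in ewald θ η r, ‖g₁ ξ‖ * ‖g₂ (η - ξ)‖ ∂μH[(n : ℝ) - 1]
  else 0

/-- Weighted norm `‖F‖_{L²_α}`. -/
def L2w {n : ℕ} {G : Type*} [NormedAddCommGroup G] (α : ℝ) (F : En n → G) : ℝ :=
  (∫ η, jap η ^ (2 * α) * ‖F η‖ ^ 2) ^ (1/2 : ℝ)

/-- Weighted Sobolev norm `‖q‖_{W^{β,2}_δ} = ‖⟨·⟩^δ 𝓕⁻¹(⟨·⟩^β 𝓕q)‖_{L²}`. -/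
def sobNorm {n : ℕ} (β δ : ℝ) (q : En n → ℂ) : ℝ :=
  (∫ x, jap x ^ (2 * δ) * ‖𝓕⁻ (fun ξ => (jap ξ ^ β : ℝ) • 𝓕 q ξ) x‖ ^ 2) ^ (1/2 : ℝ)

/-- A smooth radial cutoff vanishing for `|ξ| < C₀` and equal to `1` for `|ξ| > 2C₀`. -/
structure IsCutoff {n : ℕ} (C₀ : ℝ) (χ : En n → ℝ) : Prop where
  smooth : ContDiff ℝ (⊤ : ℕ∞) χ
  mem_Icc : ∀ ξ, χ ξ ∈ Set.Icc (0 : ℝ) 1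
  eq_one : ∀ ξ : En n, 2 * C₀ < ‖ξ‖ → χ ξ = 1
  eq_zero : ∀ ξ : En n, ‖ξ‖ < C₀ → χ ξ = 0




lemma oneD_cov (f : ℝ → ℝ) (E : Set ℝ) (hE : MeasurableSet E)
    (hf : ∀ t ∈ E, DifferentiableAt ℝ f t) (hd : ∀ t ∈ E, 1 / 2 ≤ |deriv f t|)
    (N : ℕ) (hN : ∀ v, (E ∩ f ⁻¹' {v}).encard ≤ N) (G : ℝ → ℝ≥0∞)
    (hG : Measurable G) :
    ∫⁻ t in E, G (f t) ≤ 2 * N * ∫⁻ s, G s := by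
  classical
  obtain ⟨t, A, hdis, hmeas, hcov, happ, hA⟩ :=
    exists_partition_approximatesLinearOn_of_hasFDerivWithinAt f E (fderiv ℝ f)
      (fun x hx => (hf x hx).hasFDerivAt.hasFDerivWithinAt)
      (fun L => if L 1 = 0 then 1 else ‖L 1‖₊ / 2) (by
        intro L
        split_ifs with h
        · exact one_ne_zero
        · simpa using h)
  have hinj : ∀ q, InjOn f (E ∩ t q) := by
    intro q x hx y hy hxy
    have hne : E.Nonempty := ⟨x, hx.1⟩
    obtain ⟨y0, hy0, hAy⟩ := hA hne q
    have h1 : A q 1 ≠ 0 := by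
      rw [hAy]
      have := hd y0 hy0
      rw [fderiv_eq_smul_deriv]
      intro h0
      simp at h0
      rw [h0] at this
      norm_num at this
    have := (happ q) x hx y hy
    rw [hxy, if_neg h1] at this
    have e : A q (x - y) = (x - y) * A q 1 := by
      have : x - y = (x - y) • (1 : ℝ) := by simp
      conv_lhs => rw [this]
      rw [map_smul]; simp
    rw [e] at this
    simp only [sub_self, zero_sub, norm_neg, norm_mul, NNReal.coe_div, coe_nnnorm,
      NNReal.coe_ofNat] at this
    have hp : 0 < ‖A q 1‖ := norm_pos_iff.mpr h1
    have h3 : ‖x - y‖ ≤ 0 := by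
      by_contra h
      push Not at h
      nlinarith [mul_pos h hp]
    exact sub_eq_zero.mp (norm_le_zero_iff.mp h3)
  have hme : ∀ q, MeasurableSet (E ∩ t q) := fun q => hE.inter (hmeas q)
  have hEq : E = ⋃ q, E ∩ t q := by
    rw [← inter_iUnion]; exact (inter_eq_left.mpr hcov).symm
  have himg : ∀ q, MeasurableSet (f '' (E ∩ t q)) := by
    intro q
    exact measurable_image_of_fderivWithin (hme q)
      (fun x hx => (hf x hx.1).hasFDerivAt.hasFDerivWithinAt) (hinj q)
  have hpiece : ∀ q, ∫⁻ x in E ∩ t q, G (f x) ≤ 2 * ∫⁻ s, (f '' (E ∩ t q)).indicator G s := by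
    intro q
    rw [lintegral_indicator (himg q),
      lintegral_image_eq_lintegral_abs_deriv_mul (hme q)
        (fun x hx => (hf x hx.1).hasDerivAt.hasDerivWithinAt) (hinj q),
      ← lintegral_const_mul' _ _ (by norm_num)]
    refine setLIntegral_mono' (hme q) ?_
    intro x hx
    have h2 : (1 : ℝ≥0∞) ≤ 2 * ENNReal.ofReal |deriv f x| := by
      have : (2 : ℝ≥0∞) = ENNReal.ofReal 2 := by simp
      rw [this, ← ENNReal.ofReal_mul (by norm_num), ← ENNReal.ofReal_one]
      apply ENNReal.ofReal_le_ofReal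
      have := hd x hx.1
      linarith
    calc G (f x) = 1 * G (f x) := (one_mul _).symm
      _ ≤ _ := by rw [← mul_assoc]; gcongr
  have hsum : ∀ s, ∑' q, (f '' (E ∩ t q)).indicator G s ≤ N * G s := by
    intro s
    rw [ENNReal.tsum_eq_iSup_sum]
    refine iSup_le ?_
    intro F
    have e1 : ∑ q ∈ F, (f '' (E ∩ t q)).indicator G s
        = ((F.filter (fun q => s ∈ f '' (E ∩ t q))).card : ℝ≥0∞) * G s := by
      rw [← nsmul_eq_mul, ← Finset.sum_const, Finset.sum_filter]
      refine Finset.sum_congr rfl ?_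
      intro q _
      by_cases h : s ∈ f '' (E ∩ t q)
      · rw [indicator_of_mem h, if_pos h]
      · rw [indicator_of_notMem h, if_neg h]
    rw [e1]
    gcongr
    have hex : ∀ q ∈ F.filter (fun q => s ∈ f '' (E ∩ t q)), ∃ x, x ∈ E ∩ t q ∧ f x = s := by
      intro q hq
      obtain ⟨x, hx, hxs⟩ := (Finset.mem_filter.mp hq).2
      exact ⟨x, hx, hxs⟩
    choose! p hp hps using hex
    have hle : (((F.filter (fun q => s ∈ f '' (E ∩ t q))).card : ℕ) : ℕ∞) ≤ N := by
      have hpi : InjOn p (F.filter (fun q => s ∈ f '' (E ∩ t q)) : Set ℕ) := by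
        intro a ha b hb hab
        by_contra hne
        have := (hdis hne)
        exact Set.disjoint_left.mp this (hp a ha).2 (hab ▸ (hp b hb).2)
      calc (((F.filter (fun q => s ∈ f '' (E ∩ t q))).card : ℕ) : ℕ∞)
          = (F.filter (fun q => s ∈ f '' (E ∩ t q)) : Set ℕ).encard :=
            (Set.encard_coe_eq_coe_finsetCard _).symm
        _ = (p '' (F.filter (fun q => s ∈ f '' (E ∩ t q)) : Set ℕ)).encard :=
            (hpi.encard_image).symm
        _ ≤ (E ∩ f ⁻¹' {s}).encard := by
            apply Set.encard_le_encard
            rintro _ ⟨q, hq, rfl⟩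
            exact ⟨(hp q hq).1, hps q hq⟩
        _ ≤ N := hN s
    exact_mod_cast hle
  calc ∫⁻ x in E, G (f x) ≤ ∑' q, ∫⁻ x in E ∩ t q, G (f x) := by
        conv_lhs => rw [hEq]
        exact lintegral_iUnion_le _ _
    _ ≤ ∑' q, 2 * ∫⁻ s, (f '' (E ∩ t q)).indicator G s := ENNReal.tsum_le_tsum hpiece
    _ = 2 * ∫⁻ s, ∑' q, (f '' (E ∩ t q)).indicator G s := by
        rw [ENNReal.tsum_mul_left, lintegral_tsum]
        exact fun q => (hG.indicator (himg q)).aemeasurable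
    _ ≤ 2 * ∫⁻ s, N * G s := by gcongr; exact hsum _
    _ = 2 * N * ∫⁻ s, G s := by
        rw [lintegral_const_mul _ hG, mul_assoc]



/-- Insert coordinate `t` at position `i`. -/
def ins {m : ℕ} (i : Fin (m + 1)) (t : ℝ) (x : Fin m → ℝ) : En (m + 1) :=
  WithLp.toLp 2 (Fin.insertNth (α := fun _ => ℝ) i t x)

/-- Drop coordinate `i`. -/
def drp {m : ℕ} (i : Fin (m + 1)) (ξ : En (m + 1)) : Fin m → ℝ := fun l => ξ (i.succAbove l)

@[simp] lemma ins_self {m : ℕ} (i : Fin (m + 1)) (t : ℝ) (x : Fin m → ℝ) : ins i t x i = t := by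
  simp [ins]

@[simp] lemma ins_succ {m : ℕ} (i : Fin (m + 1)) (t : ℝ) (x : Fin m → ℝ) (l : Fin m) :
    ins i t x (i.succAbove l) = x l := by
  simp [ins]

lemma ins_drp {m : ℕ} (i : Fin (m + 1)) (ξ : En (m + 1)) : ins i (ξ i) (drp i ξ) = ξ := by
  ext j
  rcases Fin.eq_self_or_eq_succAbove i j with h | ⟨l, rfl⟩
  · subst h; simp
  · simp [drp]

lemma ins_sub {m : ℕ} (i : Fin (m + 1)) (t s : ℝ) (x y : Fin m → ℝ) :
    ins i t x - ins i s y = ins i (t - s) (x - y) := by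
  ext j
  rcases Fin.eq_self_or_eq_succAbove i j with h | ⟨l, rfl⟩
  · subst h; simp
  · simp

lemma inner_ins {m : ℕ} (i : Fin (m + 1)) (t : ℝ) (x : Fin m → ℝ) (θ : En (m + 1)) :
    ⟪ins i t x, θ⟫ = t * θ i + ∑ l, x l * θ (i.succAbove l) := by
  simp [PiLp.inner_apply, Fin.sum_univ_succAbove _ i, mul_comm]

lemma norm_sq_ins {m : ℕ} (i : Fin (m + 1)) (t : ℝ) (x : Fin m → ℝ) :
    ‖ins i t x‖ ^ 2 = t ^ 2 + ∑ l, x l ^ 2 := by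
  simp [EuclideanSpace.norm_sq_eq, Fin.sum_univ_succAbove _ i]

lemma norm_sq_drp {m : ℕ} (i : Fin (m + 1)) (ξ : En (m + 1)) :
    ‖ξ‖ ^ 2 = ξ i ^ 2 + ∑ l, ξ (i.succAbove l) ^ 2 := by
  simp [EuclideanSpace.norm_sq_eq, Fin.sum_univ_succAbove _ i]

lemma continuous_ins {m : ℕ} (i : Fin (m + 1)) :
    Continuous (fun p : ℝ × (Fin m → ℝ) => ins i p.1 p.2) := by
  unfold ins
  refine (PiLp.continuous_toLp 2 _).comp ?_
  exact Continuous.finInsertNth i continuous_fst continuous_snd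

lemma measurable_ins {m : ℕ} (i : Fin (m + 1)) {X : Type*} [MeasurableSpace X] {f : X → ℝ}
    {g : X → Fin m → ℝ} (hf : Measurable f) (hg : Measurable g) :
    Measurable (fun p => ins i (f p) (g p)) :=
  (continuous_ins i).measurable.comp (hf.prodMk hg)

lemma lintegral_ins {m : ℕ} (i : Fin (m + 1)) (F : En (m + 1) → ℝ≥0∞) (hF : Measurable F) :
    ∫⁻ η, F η = ∫⁻ x : Fin m → ℝ, ∫⁻ t : ℝ, F (ins i t x) := by
  rw [← (PiLp.volume_preserving_toLp (Fin (m + 1))).lintegral_comp hF,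
    ← ((volume_preserving_piFinSuccAbove (fun _ : Fin (m + 1) => ℝ) i).symm).lintegral_comp
      (f := fun a => F (WithLp.toLp 2 a)) (hF.comp (PiLp.continuous_toLp 2 _).measurable)]
  have hm : Measurable fun p : ℝ × (Fin m → ℝ) => F (ins i p.1 p.2) :=
    hF.comp (continuous_ins i).measurable
  have := lintegral_prod_symm (μ := (volume : Measure ℝ)) (ν := (volume : Measure (Fin m → ℝ)))
    (fun p : ℝ × (Fin m → ℝ) => F (ins i p.1 p.2)) hm.aemeasurable
  exact this

/-- Discriminant of the sphere over the hyperplane of coordinates other than `i`. -/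
def gD {m : ℕ} (c : En (m + 1)) (R : ℝ) (i : Fin (m + 1)) (x : Fin m → ℝ) : ℝ :=
  R ^ 2 - ∑ l, (x l - c (i.succAbove l)) ^ 2

/-- Height of the sphere graph. -/
def gH {m : ℕ} (c : En (m + 1)) (R : ℝ) (i : Fin (m + 1)) (σ : ℝ) (x : Fin m → ℝ) : ℝ :=
  c i + σ * Real.sqrt (gD c R i x)

/-- Domain of the patch. -/
def gU {m : ℕ} (c : En (m + 1)) (R : ℝ) (i : Fin (m + 1)) : Set (Fin m → ℝ) :=
  {x | (R / (m + 1)) ^ 2 ≤ gD c R i x}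

lemma norm_ins_le {m : ℕ} (i : Fin (m + 1)) (t : ℝ) (x : Fin m → ℝ) :
    ‖ins i t x‖ ≤ |t| + m * ‖x‖ := by
  have h : ‖ins i t x‖ ^ 2 ≤ (|t| + m * ‖x‖) ^ 2 := by
    rw [norm_sq_ins]
    have h1 : ∑ l, x l ^ 2 ≤ (∑ l, |x l|) ^ 2 := by
      have := Finset.sum_sq_le_sq_sum_of_nonneg (s := Finset.univ) (f := fun l => |x l|)
        (fun l _ => abs_nonneg _)
      simpa [sq_abs] using this
    have h2 : ∑ l, |x l| ≤ m * ‖x‖ := by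
      calc ∑ l, |x l| ≤ ∑ _l : Fin m, ‖x‖ := Finset.sum_le_sum fun l _ => norm_le_pi_norm x l
        _ = _ := by simp
    have h3 : 0 ≤ ∑ l, |x l| := Finset.sum_nonneg fun l _ => abs_nonneg _
    nlinarith [abs_nonneg t, sq_abs t]
  exact le_of_sq_le_sq h (by positivity)

lemma gH_lip {m : ℕ} (c : En (m + 1)) (R : ℝ) (hR : 0 < R) (i : Fin (m + 1)) (σ : ℝ)
    (hσ : |σ| = 1) {x y : Fin m → ℝ} (hx : x ∈ gU c R i) (hy : y ∈ gU c R i) :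
    |gH c R i σ x - gH c R i σ y| ≤ (m + 1) * m * ‖x - y‖ := by
  have hm : (0 : ℝ) < m + 1 := by positivity
  have hRm : 0 < R / (m + 1) := by positivity
  have key : ∀ z ∈ gU c R i, R / (m + 1) ≤ Real.sqrt (gD c R i z) ∧ 0 ≤ gD c R i z ∧
      ∀ l, |z l - c (i.succAbove l)| ≤ R := by
    intro z hz
    have h1 : (R / (m + 1)) ^ 2 ≤ gD c R i z := hz
    have h0 : 0 ≤ gD c R i z := le_trans (by positivity) h1
    refine ⟨Real.le_sqrt_of_sq_le h1, h0, ?_⟩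
    intro l
    have h2 : (z l - c (i.succAbove l)) ^ 2 ≤ ∑ l, (z l - c (i.succAbove l)) ^ 2 :=
      Finset.single_le_sum (f := fun l => (z l - c (i.succAbove l)) ^ 2)
        (fun l _ => sq_nonneg _) (Finset.mem_univ l)
    unfold gD at h0
    exact abs_le_of_sq_le_sq (by linarith) hR.le
  obtain ⟨x1, x2, x3⟩ := key x hx
  obtain ⟨y1, y2, y3⟩ := key y hy
  have hd : |gD c R i x - gD c R i y| ≤ 2 * R * (m * ‖x - y‖) := by
    have e : gD c R i x - gD c R i y = ∑ l, (y l - x l) *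
        ((y l - c (i.succAbove l)) + (x l - c (i.succAbove l))) := by
      unfold gD
      rw [sub_sub_sub_cancel_left, ← Finset.sum_sub_distrib]
      exact Finset.sum_congr rfl fun l _ => by ring
    rw [e]
    calc _ ≤ ∑ l, |(y l - x l) * ((y l - c (i.succAbove l)) + (x l - c (i.succAbove l)))| :=
          Finset.abs_sum_le_sum_abs _ _
      _ ≤ ∑ _l : Fin m, ‖x - y‖ * (2 * R) := by
          refine Finset.sum_le_sum fun l _ => ?_
          rw [abs_mul]
          gcongr
          · have := norm_le_pi_norm (x - y) l
            rwa [Pi.sub_apply, Real.norm_eq_abs, abs_sub_comm] at this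
          · refine (abs_add_le _ _).trans ?_
            linarith [x3 l, y3 l]
      _ = _ := by simp; ring
  have hs : (Real.sqrt (gD c R i x) - Real.sqrt (gD c R i y)) *
      (Real.sqrt (gD c R i x) + Real.sqrt (gD c R i y)) = gD c R i x - gD c R i y := by
    have := Real.sq_sqrt x2
    have := Real.sq_sqrt y2
    nlinarith
  have e2 : gH c R i σ x - gH c R i σ y
      = σ * (Real.sqrt (gD c R i x) - Real.sqrt (gD c R i y)) := by
    unfold gH; ring
  rw [e2, abs_mul, hσ, one_mul]
  rw [← hs, abs_mul] at hd
  have hsum : 2 * R / (m + 1) ≤ |Real.sqrt (gD c R i x) + Real.sqrt (gD c R i y)| := by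
    refine le_trans ?_ (le_abs_self _)
    have : 2 * R / (m + 1) = R / (m + 1) + R / (m + 1) := by ring
    linarith
  have h5 : |Real.sqrt (gD c R i x) - Real.sqrt (gD c R i y)| * (2 * R / (m + 1)) ≤
      2 * R * (m * ‖x - y‖) := le_trans (by gcongr) hd
  have h6 : |Real.sqrt (gD c R i x) - Real.sqrt (gD c R i y)| * (2 * R / (m + 1))
      = (2 * R) * (|Real.sqrt (gD c R i x) - Real.sqrt (gD c R i y)| / (m + 1)) := by ring
  rw [h6] at h5
  have h7 := le_of_mul_le_mul_left h5 (by positivity)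
  rw [div_le_iff₀ hm] at h7
  linarith

lemma measurable_gD {m : ℕ} (c : En (m + 1)) (R : ℝ) (i : Fin (m + 1)) :
    Continuous (gD c R i) := by
  unfold gD; fun_prop

lemma patch_meas {m : ℕ} (c : En (m + 1)) (R : ℝ) (hR : 0 < R) (i : Fin (m + 1)) (σ : ℝ)
    (hσ : |σ| = 1) (H : En (m + 1) → ℝ≥0∞) (hH : Measurable H) :
    ∫⁻ ξ in (fun x => ins i (gH c R i σ x) x) '' gU c R i, H ξ ∂μH[(m : ℝ)] ≤
      ENNReal.ofReal (((m + 2 : ℝ) ^ 2) ^ (m : ℝ)) *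
        ∫⁻ x in gU c R i, H (ins i (gH c R i σ x) x) := by
  set Ψ : (Fin m → ℝ) → En (m + 1) := fun x => ins i (gH c R i σ x) x with hΨ
  have hcont : Continuous (gH c R i σ) := by
    unfold gH
    have := measurable_gD c R i
    fun_prop
  have hΨm : Measurable Ψ := measurable_ins i hcont.measurable measurable_id
  have hlip : LipschitzOnWith (Real.toNNReal ((m + 2 : ℝ) ^ 2)) Ψ (gU c R i) := by
    refine LipschitzOnWith.of_dist_le_mul ?_
    intro x hx y hy
    rw [dist_eq_norm, dist_eq_norm, Real.coe_toNNReal _ (by positivity), hΨ]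
    simp only
    rw [ins_sub]
    refine (norm_ins_le _ _ _).trans ?_
    have := gH_lip c R hR i σ hσ hx hy
    have h0 := norm_nonneg (x - y)
    have hm : (0 : ℝ) ≤ m := by positivity
    nlinarith
  have hUm : MeasurableSet (gU c R i) :=
    measurableSet_le measurable_const (measurable_gD c R i).measurable
  have hle : (μH[(m : ℝ)] : Measure (En (m + 1))).restrict (Ψ '' gU c R i) ≤
      ENNReal.ofReal (((m + 2 : ℝ) ^ 2) ^ (m : ℝ)) • (volume.restrict (gU c R i)).map Ψ := by
    rw [Measure.le_iff]
    intro s hs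
    rw [Measure.restrict_apply hs, Measure.smul_apply, Measure.map_apply hΨm hs,
      Measure.restrict_apply (hΨm hs)]
    have hsub : s ∩ Ψ '' gU c R i ⊆ Ψ '' (Ψ ⁻¹' s ∩ gU c R i) := by
      rintro _ ⟨h1, x, hx, rfl⟩
      exact ⟨x, ⟨h1, hx⟩, rfl⟩
    refine (measure_mono hsub).trans ?_
    refine ((hlip.mono inter_subset_right).hausdorffMeasure_image_le (by positivity)).trans ?_
    have hv : (μH[(m : ℝ)] : Measure (Fin m → ℝ)) = volume := by
      have := hausdorffMeasure_pi_real (ι := Fin m)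
      simpa using this
    rw [hv, smul_eq_mul]
    gcongr
    rw [← ENNReal.ofReal_rpow_of_nonneg (by positivity) (by positivity)]
    rfl
  calc _ ≤ ∫⁻ ξ, H ξ ∂(ENNReal.ofReal (((m + 2 : ℝ) ^ 2) ^ (m : ℝ)) •
        (volume.restrict (gU c R i)).map Ψ) := lintegral_mono' hle le_rfl
    _ = _ := by
      rw [lintegral_smul_measure, lintegral_map hH hΨm, smul_eq_mul]

lemma sphere_lintegral_le {m : ℕ} (c : En (m + 1)) (R : ℝ) (hR : 0 < R)
    (H : En (m + 1) → ℝ≥0∞) (hH : Measurable H) :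
    ∫⁻ ξ in sphere c R, H ξ ∂μH[(m : ℝ)] ≤
      ENNReal.ofReal (((m + 2 : ℝ) ^ 2) ^ (m : ℝ)) *
        ∑ p ∈ (Finset.univ : Finset (Fin (m + 1))) ×ˢ ({1, -1} : Finset ℝ),
          ∫⁻ x in gU c R p.1, H (ins p.1 (gH c R p.1 p.2 x) x) := by
  set S := (Finset.univ : Finset (Fin (m + 1))) ×ˢ ({1, -1} : Finset ℝ)
  have hcov : sphere c R ⊆ ⋃ p ∈ S, (fun x => ins p.1 (gH c R p.1 p.2 x) x) '' gU c R p.1 := by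
    intro ξ hξ
    rw [mem_sphere, dist_eq_norm] at hξ
    have hsum : ∑ i, (ξ i - c i) ^ 2 = R ^ 2 := by
      rw [← hξ, EuclideanSpace.norm_sq_eq]; simp
    have hex : ∃ i, (R / (m + 1)) ^ 2 ≤ (ξ i - c i) ^ 2 := by
      by_contra hcon
      push Not at hcon
      have h1 : ∑ i, (ξ i - c i) ^ 2 < ∑ _i : Fin (m + 1), (R / (m + 1)) ^ 2 :=
        Finset.sum_lt_sum_of_nonempty Finset.univ_nonempty fun i _ => hcon i
      rw [hsum] at h1
      simp only [Finset.sum_const, Finset.card_univ, Fintype.card_fin, nsmul_eq_mul] at h1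
      push_cast at h1
      have hm : (0 : ℝ) < m + 1 := by positivity
      have e : (m + 1 : ℝ) * (R / (m + 1)) ^ 2 = R ^ 2 / (m + 1) := by field_simp
      rw [e, lt_div_iff₀ hm] at h1
      have : (0 : ℝ) ≤ m := by positivity
      nlinarith [sq_nonneg R]
    obtain ⟨i, hi⟩ := hex
    have hD : gD c R i (drp i ξ) = (ξ i - c i) ^ 2 := by
      rw [Fin.sum_univ_succAbove _ i] at hsum
      unfold gD drp
      linarith
    have hsq : Real.sqrt (gD c R i (drp i ξ)) = |ξ i - c i| := by
      rw [hD, Real.sqrt_sq_eq_abs]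
    have hmem : drp i ξ ∈ gU c R i := by
      show (R / (m + 1)) ^ 2 ≤ gD c R i (drp i ξ)
      rw [hD]; exact hi
    rcases le_total 0 (ξ i - c i) with h | h
    · refine mem_biUnion (x := (i, (1 : ℝ))) (by simp [S]) ⟨drp i ξ, hmem, ?_⟩
      simp only
      have : gH c R i 1 (drp i ξ) = ξ i := by
        unfold gH; rw [hsq, abs_of_nonneg h]; ring
      rw [this, ins_drp]
    · refine mem_biUnion (x := (i, (-1 : ℝ))) (by simp [S]) ⟨drp i ξ, hmem, ?_⟩
      simp only
      have : gH c R i (-1) (drp i ξ) = ξ i := by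
        unfold gH; rw [hsq, abs_of_nonpos h]; ring
      rw [this, ins_drp]
  refine (lintegral_mono_set hcov).trans ?_
  have hfin : ∀ T : Finset (Fin (m + 1) × ℝ),
      ∫⁻ ξ in ⋃ p ∈ T, (fun x => ins p.1 (gH c R p.1 p.2 x) x) '' gU c R p.1, H ξ ∂μH[(m : ℝ)] ≤
      ∑ p ∈ T, ∫⁻ ξ in (fun x => ins p.1 (gH c R p.1 p.2 x) x) '' gU c R p.1, H ξ ∂μH[(m : ℝ)] := by
    classical
    intro T
    induction T using Finset.induction_on with
    | empty => simp
    | insert a T ha ih =>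
      rw [Finset.set_biUnion_insert, Finset.sum_insert ha]
      exact (lintegral_union_le _ _ _).trans (add_le_add le_rfl ih)
  refine (hfin S).trans ?_
  rw [Finset.mul_sum]
  refine Finset.sum_le_sum ?_
  rintro ⟨i, σ⟩ hp
  refine patch_meas c R hR i σ ?_ H hH
  have : σ = 1 ∨ σ = -1 := by simpa [S] using hp
  rcases this with rfl | rfl <;> simp



lemma half_line_pot (a R : ℝ) (ha1 : a < 1) (hR : 0 < R) :
    ∫⁻ t in Ioc 0 R, (ENNReal.ofReal |t|) ^ (-a) ≤ ENNReal.ofReal (R ^ (1 - a) / (1 - a)) := by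
  have h1 : ∫⁻ t in Ioc 0 R, (ENNReal.ofReal |t|) ^ (-a)
      = ∫⁻ t in Ioc 0 R, ENNReal.ofReal (t ^ (-a)) := by
    refine setLIntegral_congr_fun measurableSet_Ioc ?_
    intro t ht
    simp only
    rw [abs_of_pos ht.1, ENNReal.ofReal_rpow_of_pos ht.1]
  have h_integ : IntegrableOn (fun t : ℝ => t ^ (-a)) (Ioc 0 R) := by
    have := intervalIntegral.intervalIntegrable_rpow' (a := 0) (b := R) (r := -a) (by linarith)
    rwa [intervalIntegrable_iff_integrableOn_Ioc_of_le hR.le] at this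
  rw [h1, ← ofReal_integral_eq_lintegral_ofReal h_integ]
  · apply ENNReal.ofReal_le_ofReal
    rw [← intervalIntegral.integral_of_le hR.le, integral_rpow (Or.inl (by linarith))]
    rw [Real.zero_rpow (by linarith)]
    rw [show -a + 1 = 1 - a by ring, sub_zero]
  · rw [EventuallyLE, ae_restrict_iff' measurableSet_Ioc]
    filter_upwards with t ht
    exact Real.rpow_nonneg ht.1.le _

lemma line_pot (a R c p : ℝ) (ha0 : 0 ≤ a) (ha1 : a < 1) (hR : 0 < R) :
    ∫⁻ t in {t : ℝ | |t - c| ≤ R}, (ENNReal.ofReal |t - p|) ^ (-a) ≤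
      ENNReal.ofReal ((2 / (1 - a) + 2) * R ^ (1 - a)) := by
  have hsub : {t : ℝ | |t - c| ≤ R} ⊆ {t | |t - p| ≤ R} ∪ ({t | |t - c| ≤ R} ∩ {t | R < |t - p|}) := by
    intro t ht
    rcases le_or_gt |t - p| R with h | h
    · exact Or.inl h
    · exact Or.inr ⟨ht, h⟩
  have h1a : 0 < 1 - a := by linarith
  have hRa : 0 < R ^ (1 - a) := Real.rpow_pos_of_pos hR _
  have hA : ∫⁻ t in {t : ℝ | |t - p| ≤ R}, (ENNReal.ofReal |t - p|) ^ (-a) ≤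
      ENNReal.ofReal (2 / (1 - a) * R ^ (1 - a)) := by
    have e : ∫⁻ t in {t : ℝ | |t - p| ≤ R}, (ENNReal.ofReal |t - p|) ^ (-a)
        = ∫⁻ t in Icc (-R) R, (ENNReal.ofReal |t|) ^ (-a) := by
      rw [← lintegral_indicator measurableSet_Icc, ← lintegral_indicator
        (measurableSet_le (by fun_prop) measurable_const),
        ← lintegral_sub_right_eq_self (fun t => (Icc (-R) R).indicator (fun t => (ENNReal.ofReal |t|) ^ (-a)) t) p]
      refine lintegral_congr fun t => ?_
      by_cases h : |t - p| ≤ R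
      · rw [indicator_of_mem (by exact h), indicator_of_mem (by exact abs_le.mp h)]
      · rw [indicator_of_notMem (by exact h), indicator_of_notMem (by
          intro h'; exact h (abs_le.mpr h'))]
    have hsub2 : Icc (-R) R ⊆ (Ico (-R) 0 ∪ Ioc 0 R) ∪ {0} := by
      intro t ht
      rcases lt_trichotomy t 0 with h | h | h
      · exact Or.inl (Or.inl ⟨ht.1, h⟩)
      · exact Or.inr h
      · exact Or.inl (Or.inr ⟨h, ht.2⟩)
    have hneg : ∫⁻ t in Ico (-R) 0, (ENNReal.ofReal |t|) ^ (-a)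
        = ∫⁻ t in Ioc 0 R, (ENNReal.ofReal |t|) ^ (-a) := by
      rw [← lintegral_indicator measurableSet_Ico, ← lintegral_indicator measurableSet_Ioc,
        ← lintegral_neg_eq_self]
      refine lintegral_congr fun t => ?_
      by_cases h : t ∈ Ioc 0 R
      · rw [indicator_of_mem h, indicator_of_mem (by
          exact ⟨by linarith [h.2], by linarith [h.1]⟩), abs_neg]
      · rw [indicator_of_notMem h, indicator_of_notMem (by
          intro h'; exact h ⟨by linarith [h'.2], by linarith [h'.1]⟩)]
    rw [e]
    calc _ ≤ ∫⁻ t in (Ico (-R) 0 ∪ Ioc 0 R) ∪ {0}, (ENNReal.ofReal |t|) ^ (-a) :=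
          lintegral_mono_set hsub2
      _ ≤ ((∫⁻ t in Ico (-R) 0, (ENNReal.ofReal |t|) ^ (-a)) +
            (∫⁻ t in Ioc 0 R, (ENNReal.ofReal |t|) ^ (-a))) +
            ∫⁻ t in ({0} : Set ℝ), (ENNReal.ofReal |t|) ^ (-a) :=
          (lintegral_union_le _ _ _).trans (add_le_add (lintegral_union_le _ _ _) le_rfl)
      _ ≤ (ENNReal.ofReal (R ^ (1 - a) / (1 - a)) + ENNReal.ofReal (R ^ (1 - a) / (1 - a))) + 0 := by
          gcongr
          · rw [hneg]; exact half_line_pot a R ha1 hR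
          · exact half_line_pot a R ha1 hR
          · simp
      _ = _ := by
          rw [add_zero, ← ENNReal.ofReal_add (by positivity) (by positivity)]
          congr 1; ring
  have hB : ∫⁻ t in {t : ℝ | |t - c| ≤ R} ∩ {t | R < |t - p|}, (ENNReal.ofReal |t - p|) ^ (-a) ≤
      ENNReal.ofReal (2 * R ^ (1 - a)) := by
    calc _ ≤ ∫⁻ t in {t : ℝ | |t - c| ≤ R} ∩ {t | R < |t - p|}, (ENNReal.ofReal R) ^ (-a) := by
          refine setLIntegral_mono' ((measurableSet_le (by fun_prop) measurable_const).inter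
            (measurableSet_lt measurable_const (by fun_prop))) ?_
          intro t ht
          rw [ENNReal.rpow_neg, ENNReal.rpow_neg]
          gcongr
          exact ht.2.le
      _ ≤ ∫⁻ t in Icc (c - R) (c + R), (ENNReal.ofReal R) ^ (-a) := by
          refine lintegral_mono_set ?_
          intro t ht
          have h0 : |t - c| ≤ R := ht.1
          have := abs_le.mp h0
          exact ⟨by linarith [this.1], by linarith [this.2]⟩
      _ = _ := by
          rw [setLIntegral_const, Real.volume_Icc, ENNReal.ofReal_rpow_of_pos hR,
            ← ENNReal.ofReal_mul (by positivity)]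
          congr 1
          rw [show c + R - (c - R) = 2 * R by ring, show 1 - a = -a + 1 by ring,
            Real.rpow_add hR, Real.rpow_one]
          ring
  calc _ ≤ _ := lintegral_mono_set hsub
    _ ≤ _ := lintegral_union_le _ _ _
    _ ≤ _ := add_le_add hA hB
    _ = _ := by
      rw [← ENNReal.ofReal_add (by positivity) (by positivity)]
      congr 1; ring

lemma prod_lint : ∀ (m : ℕ) (f : Fin m → ℝ → ℝ≥0∞), (∀ l, Measurable (f l)) →
    ∫⁻ x : Fin m → ℝ, ∏ l, f l (x l) = ∏ l, ∫⁻ t, f l t := by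
  intro m
  induction m with
  | zero => intro f hf; simp [lintegral_const]; rw [volume_pi, Measure.pi_of_empty _ (0 : Fin 0 → ℝ)]; simp
  | succ m ih =>
    intro f hf
    have hm : Measurable fun x : Fin (m + 1) → ℝ => ∏ l, f l (x l) :=
      Finset.measurable_prod _ fun l _ => (hf l).comp (measurable_pi_apply l)
    rw [← ((volume_preserving_piFinSuccAbove (fun _ : Fin (m + 1) => ℝ) 0).symm).lintegral_comp hm]
    have e : ∀ p : ℝ × (Fin m → ℝ), ∏ l, f l ((MeasurableEquiv.piFinSuccAbove (fun _ : Fin (m + 1) => ℝ) 0).symm p l)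
        = f 0 p.1 * ∏ l : Fin m, f l.succ (p.2 l) := by
      intro p
      rw [Fin.prod_univ_succ]
      congr 1
    simp_rw [e]
    rw [Measure.volume_eq_prod, lintegral_prod_mul (f := f 0) (g := fun y : Fin m → ℝ => ∏ l : Fin m, f l.succ (y l)),
      ih (fun l => f l.succ) (fun l => hf _), Fin.prod_univ_succ]
    · exact (hf 0).aemeasurable
    · exact (Finset.measurable_prod _ fun l _ => (hf _).comp (measurable_pi_apply l)).aemeasurable

lemma one_le_jap {n : ℕ} (v : En n) : 1 ≤ jap v := by
  unfold jap
  rw [Real.one_le_sqrt]; nlinarith [sq_nonneg ‖v‖]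

lemma jap_pos {n : ℕ} (v : En n) : 0 < jap v := lt_of_lt_of_le one_pos (one_le_jap v)

lemma jap_sq {n : ℕ} (v : En n) : jap v ^ 2 = 1 + ‖v‖ ^ 2 := by
  unfold jap
  rw [Real.sq_sqrt (by positivity)]

lemma norm_le_jap {n : ℕ} (v : En n) : ‖v‖ ≤ jap v := by
  unfold jap
  apply Real.le_sqrt_of_sq_le; linarith

lemma coord_le_jap {n : ℕ} (v : En n) (l : Fin n) : |v l| ≤ jap v := by
  have := PiLp.norm_apply_le v l
  exact (by simpa using this : |v l| ≤ ‖v‖).trans (norm_le_jap v)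

lemma continuous_jap {n : ℕ} : Continuous (jap (n := n)) := by
  unfold jap; fun_prop

set_option maxHeartbeats 1000000 in
/-- Potential estimate on spheres. -/
lemma sphere_pot {m : ℕ} (hm : 1 ≤ m) (b : ℝ) (hb0 : 0 ≤ b) (hb : 2 * b < m) :
    ∃ C : ℝ, 0 < C ∧ ∀ (c p : En (m + 1)) (R : ℝ), 0 < R →
      ∫⁻ ξ in sphere c R, ENNReal.ofReal (jap (ξ - p) ^ (-(2 * b))) ∂μH[(m : ℝ)] ≤
        ENNReal.ofReal (C * R ^ ((m : ℝ) - 2 * b)) := by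
  have hm0 : (0 : ℝ) < m := by exact_mod_cast hm
  set a : ℝ := 2 * b / m with ha
  have ha0 : 0 ≤ a := by positivity
  have ha1 : a < 1 := by rw [ha, div_lt_one hm0]; exact hb
  have ham : a * m = 2 * b := by rw [ha]; field_simp
  set D : ℝ := 2 / (1 - a) + 2 with hD
  have hD0 : 0 < D := by
    have : 0 < 1 - a := by linarith
    positivity
  set S := (Finset.univ : Finset (Fin (m + 1))) ×ˢ ({1, -1} : Finset ℝ) with hS
  refine ⟨((m + 2 : ℝ) ^ 2) ^ (m : ℝ) * ((S.card + 1) * D ^ m), by positivity, ?_⟩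
  intro c p R hR
  have hmeas : Measurable fun ξ : En (m + 1) => ENNReal.ofReal (jap (ξ - p) ^ (-(2 * b))) := by
    have : Continuous fun ξ : En (m + 1) => jap (ξ - p) := continuous_jap.comp (by fun_prop)
    exact ENNReal.measurable_ofReal.comp (this.measurable.pow_const _)
  refine (sphere_lintegral_le c R hR _ hmeas).trans ?_
  have key : ∀ q ∈ S, ∫⁻ x in gU c R q.1, ENNReal.ofReal
      (jap (ins q.1 (gH c R q.1 q.2 x) x - p) ^ (-(2 * b))) ≤
      ENNReal.ofReal (D ^ m * R ^ ((m : ℝ) - 2 * b)) := by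
    rintro ⟨i, σ⟩ -
    simp only
    set F : Fin m → ℝ → ℝ≥0∞ := fun l => ({t : ℝ | |t - c (i.succAbove l)| ≤ R}).indicator
      (fun t => (ENNReal.ofReal |t - p (i.succAbove l)|) ^ (-a)) with hF
    have hms : ∀ l, MeasurableSet {t : ℝ | |t - c (i.succAbove l)| ≤ R} := fun l =>
      measurableSet_le (by fun_prop) measurable_const
    have hFm : ∀ l, Measurable (F l) := fun l =>
      Measurable.indicator (by fun_prop) (hms l)
    have hUm : MeasurableSet (gU c R i) := measurableSet_le measurable_const (measurable_gD c R i).measurable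
    calc _ ≤ ∫⁻ x in gU c R i, ∏ l, F l (x l) := by
          refine setLIntegral_mono' hUm ?_
          intro x hx
          have hx' : (R / (m + 1)) ^ 2 ≤ R ^ 2 - ∑ l, (x l - c (i.succAbove l)) ^ 2 := hx
          have hxl : ∀ l, |x l - c (i.succAbove l)| ≤ R := by
            intro l
            have h1 := Finset.single_le_sum (f := fun l => (x l - c (i.succAbove l)) ^ 2)
              (s := Finset.univ) (fun l _ => sq_nonneg _) (Finset.mem_univ l)
            simp only at h1
            apply abs_le_of_sq_le_sq _ hR.le
            nlinarith [sq_nonneg (R / (m + 1))]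
          set v := ins i (gH c R i σ x) x - p with hv
          have e1 : ENNReal.ofReal (jap v ^ (-(2 * b))) = ∏ l : Fin m, (ENNReal.ofReal (jap v)) ^ (-a) := by
            rw [Finset.prod_const, Finset.card_univ, Fintype.card_fin, ← ENNReal.rpow_natCast,
              ← ENNReal.rpow_mul, ENNReal.ofReal_rpow_of_pos (jap_pos v)]
            congr 2; linarith
          rw [e1]
          refine Finset.prod_le_prod' fun l _ => ?_
          rw [hF]
          simp only
          rw [indicator_of_mem (by exact hxl l), ENNReal.rpow_neg, ENNReal.rpow_neg]
          gcongr
          have := coord_le_jap v (i.succAbove l)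
          simpa [hv] using this
      _ ≤ ∫⁻ x : Fin m → ℝ, ∏ l, F l (x l) := setLIntegral_le_lintegral _ _
      _ = ∏ l, ∫⁻ t, F l t := prod_lint m F hFm
      _ ≤ ∏ l : Fin m, ENNReal.ofReal (D * R ^ (1 - a)) := by
          refine Finset.prod_le_prod' fun l _ => ?_
          rw [hF]
          simp only
          rw [lintegral_indicator (hms l)]
          exact line_pot a R _ _ ha0 ha1 hR
      _ = _ := by
          rw [Finset.prod_const, Finset.card_univ, Fintype.card_fin, ← ENNReal.ofReal_pow (by positivity)]
          congr 1
          rw [mul_pow, ← Real.rpow_natCast (R ^ (1 - a)), ← Real.rpow_mul hR.le]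
          congr 2; linarith
  calc _ ≤ ENNReal.ofReal (((m + 2 : ℝ) ^ 2) ^ (m : ℝ)) * ∑ q ∈ S, ENNReal.ofReal (D ^ m * R ^ ((m : ℝ) - 2 * b)) := by
        gcongr with q hq
        exact key q hq
    _ = ENNReal.ofReal (((m + 2 : ℝ) ^ 2) ^ (m : ℝ)) * ENNReal.ofReal (S.card * (D ^ m * R ^ ((m : ℝ) - 2 * b))) := by
        rw [Finset.sum_const, nsmul_eq_mul, ENNReal.ofReal_mul (by positivity : (0:ℝ) ≤ S.card), ENNReal.ofReal_natCast]
    _ ≤ _ := by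
        rw [← ENNReal.ofReal_mul (by positivity)]
        apply ENNReal.ofReal_le_ofReal
        have : 0 < D ^ m * R ^ ((m : ℝ) - 2 * b) := by positivity
        rw [mul_assoc]
        refine mul_le_mul_of_nonneg_left ?_ (by positivity)
        nlinarith



/-- One-dimensional version of `k`. -/
def kk (Q L e t : ℝ) : ℝ := -(t ^ 2 + Q) / (t * e + L)

/-- One-dimensional version of the discriminant. -/
def dd (r Q L e S M t : ℝ) : ℝ :=
  (r * kk Q L e t) ^ 2 - S - 2 * kk Q L e t * M - kk Q L e t ^ 2 * (1 - e ^ 2)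

/-- One-dimensional version of the graph height. -/
def pp (r Q L e S M σ t : ℝ) : ℝ := -(kk Q L e t) * e + σ * Real.sqrt (dd r Q L e S M t)

/-- The polynomial whose roots contain the fibres. -/
def qpol (r Q L e S M a v : ℝ) : Polynomial ℝ :=
  (Polynomial.C S + (Polynomial.C a * Polynomial.X + Polynomial.C v) ^ 2) *
      (Polynomial.C e * Polynomial.X + Polynomial.C L) ^ 2
    - 2 * (Polynomial.X ^ 2 + Polynomial.C Q) * (Polynomial.C e * Polynomial.X + Polynomial.C L) *
      (Polynomial.C M + (Polynomial.C a * Polynomial.X + Polynomial.C v) * Polynomial.C e)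
    + Polynomial.C (1 - r ^ 2) * (Polynomial.X ^ 2 + Polynomial.C Q) ^ 2

lemma qpol_deg (r Q L e S M a v : ℝ) : (qpol r Q L e S M a v).natDegree ≤ 4 := by
  unfold qpol
  compute_degree

lemma qpol_eval (r Q L e S M a v t : ℝ) : (qpol r Q L e S M a v).eval t =
    (S + (a * t + v) ^ 2) * (e * t + L) ^ 2 - 2 * (t ^ 2 + Q) * (e * t + L) * (M + (a * t + v) * e)
      + (1 - r ^ 2) * (t ^ 2 + Q) ^ 2 := by
  unfold qpol
  simp

lemma qpol_key (r Q L e S M a v t : ℝ) (hP : t * e + L ≠ 0) :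
    (qpol r Q L e S M a v).eval t =
      ((a * t + v + kk Q L e t * e) ^ 2 - dd r Q L e S M t) * (t * e + L) ^ 2 := by
  rw [qpol_eval]
  unfold dd kk
  field_simp
  ring

lemma continuousAt_kk (Q L e t : ℝ) (hP : t * e + L ≠ 0) : DifferentiableAt ℝ (kk Q L e) t := by
  unfold kk
  fun_prop (disch := exact hP)

lemma continuousAt_dd (r Q L e S M t : ℝ) (hP : t * e + L ≠ 0) :
    DifferentiableAt ℝ (dd r Q L e S M) t := by
  have := continuousAt_kk Q L e t hP
  unfold dd
  fun_prop

lemma diff_pp (r Q L e S M σ t : ℝ) (hP : t * e + L ≠ 0) (hd : 0 < dd r Q L e S M t) :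
    DifferentiableAt ℝ (pp r Q L e S M σ) t := by
  have h1 := continuousAt_kk Q L e t hP
  have h2 := continuousAt_dd r Q L e S M t hP
  have h3 := h2.sqrt hd.ne'
  unfold pp
  fun_prop

lemma fibre_card (r Q L e S M σ a v : ℝ) (hσ : σ ^ 2 = 1) (E : Set ℝ)
    (hE : ∀ t ∈ E, t * e + L < 0 ∧ 0 < dd r Q L e S M t ∧
      1 / 2 ≤ |deriv (fun t => pp r Q L e S M σ t - a * t) t|) :
    (E ∩ (fun t => pp r Q L e S M σ t - a * t) ⁻¹' {v}).encard ≤ (4 : ℕ) := by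
  have hroot : ∀ t ∈ E ∩ (fun t => pp r Q L e S M σ t - a * t) ⁻¹' {v},
      (qpol r Q L e S M a v).IsRoot t := by
    rintro t ⟨htE, htv⟩
    obtain ⟨hP, hd, -⟩ := hE t htE
    simp only [mem_preimage, mem_singleton_iff] at htv
    rw [Polynomial.IsRoot, qpol_key _ _ _ _ _ _ _ _ _ hP.ne]
    have h : a * t + v + kk Q L e t * e = σ * √(dd r Q L e S M t) := by
      rw [← htv]; unfold pp; ring
    rw [h, mul_pow, hσ, Real.sq_sqrt hd.le]; ring
  by_cases hq : qpol r Q L e S M a v = 0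
  · have : E ∩ (fun t => pp r Q L e S M σ t - a * t) ⁻¹' {v} = ∅ := by
      rw [eq_empty_iff_forall_notMem]
      rintro t ⟨htE, htv⟩
      obtain ⟨hP, hd, hder⟩ := hE t htE
      simp only [mem_preimage, mem_singleton_iff] at htv
      have h : σ * (a * t + v + kk Q L e t * e) = √(dd r Q L e S M t) := by
        rw [← htv]; unfold pp
        linear_combination √(dd r Q L e S M t) * hσ
      have hpos : 0 < σ * (a * t + v + kk Q L e t * e) := by rw [h]; exact Real.sqrt_pos.mpr hd
      have c1 := (continuousAt_kk Q L e t hP.ne).continuousAt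
      have ev1 : ∀ᶠ τ in nhds t, 0 < σ * (a * τ + v + kk Q L e τ * e) := by
        have : ContinuousAt (fun τ => σ * (a * τ + v + kk Q L e τ * e)) t := by fun_prop
        exact this.eventually (lt_mem_nhds hpos)
      have ev2 : ∀ᶠ τ in nhds t, τ * e + L < 0 := by
        have : ContinuousAt (fun τ : ℝ => τ * e + L) t := by fun_prop
        exact this.eventually (gt_mem_nhds hP)
      have ev : (fun t => pp r Q L e S M σ t - a * t) =ᶠ[nhds t] fun _ => v := by
        filter_upwards [ev1, ev2] with τ h1 h2
        have hk := qpol_key r Q L e S M a v τ h2.ne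
        rw [hq, Polynomial.eval_zero] at hk
        have hk2 : dd r Q L e S M τ = (σ * (a * τ + v + kk Q L e τ * e)) ^ 2 := by
          have := (mul_eq_zero.mp hk.symm).resolve_right (pow_ne_zero 2 h2.ne)
          rw [mul_pow, hσ]; linarith
        unfold pp
        rw [hk2, Real.sqrt_sq h1.le]
        linear_combination (a * τ + v + kk Q L e τ * e) * hσ
      rw [ev.deriv_eq, deriv_const] at hder
      norm_num at hder
    rw [this]; simp
  · have hsub : E ∩ (fun t => pp r Q L e S M σ t - a * t) ⁻¹' {v} ⊆
        ((qpol r Q L e S M a v).roots.toFinset : Set ℝ) := by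
      intro t ht
      simp only [Finset.mem_coe, Multiset.mem_toFinset]
      exact (Polynomial.mem_roots hq).mpr (hroot t ht)
    refine (encard_le_encard hsub).trans ?_
    rw [encard_coe_eq_coe_finsetCard]
    exact_mod_cast (Multiset.toFinset_card_le _).trans ((Polynomial.card_roots' _).trans (qpol_deg ..))

lemma line_core (r Q L e S M σ : ℝ) (hσ : σ ^ 2 = 1) (E : Set ℝ) (hEm : MeasurableSet E)
    (hE : ∀ t ∈ E, t * e + L < 0 ∧ 0 < dd r Q L e S M t) (A B : ℝ → ℝ≥0∞) (hA : Measurable A)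
    (hB : Measurable B) (As Bs : ℝ≥0∞) (hAs : ∀ t, A t ≤ As) (hBs : ∀ t, B t ≤ Bs)
    (hAi : ∫⁻ t, A t ≤ As) (hBi : ∫⁻ t, B t ≤ Bs) :
    ∫⁻ t in E, A (pp r Q L e S M σ t) * B (t - pp r Q L e S M σ t) ≤ 16 * (As * Bs) := by
  set ψ := pp r Q L e S M σ with hψ
  set E0 := E ∩ {t | 1 / 2 ≤ |deriv (fun t => ψ t - 0 * t) t|} with hE0
  set E1 := E ∩ {t | 1 / 2 ≤ |deriv (fun t => ψ t - 1 * t) t|} with hE1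
  have hE0m : MeasurableSet E0 :=
    hEm.inter (measurableSet_le measurable_const (continuous_abs.measurable.comp (measurable_deriv _)))
  have hE1m : MeasurableSet E1 :=
    hEm.inter (measurableSet_le measurable_const (continuous_abs.measurable.comp (measurable_deriv _)))
  have hdiff : ∀ t ∈ E, DifferentiableAt ℝ ψ t := fun t ht =>
    diff_pp r Q L e S M σ t (hE t ht).1.ne (hE t ht).2
  have hpm : Measurable ψ := by
    rw [hψ]; unfold pp dd kk; fun_prop
  have hcov : E ⊆ E0 ∪ E1 := by
    intro t ht
    have hd := hdiff t ht
    have h0 : deriv (fun t => ψ t - 0 * t) t = deriv ψ t := by simp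
    have h1 : deriv (fun t => ψ t - 1 * t) t = deriv ψ t - 1 := by
      simp only [one_mul]
      rw [deriv_fun_sub hd differentiableAt_fun_id]; simp
    rcases le_or_gt (1 / 2) |deriv ψ t| with h | h
    · exact Or.inl ⟨ht, by simp only [mem_setOf_eq, h0]; exact h⟩
    · refine Or.inr ⟨ht, ?_⟩
      simp only [mem_setOf_eq, h1]
      rw [abs_lt] at h
      rw [le_abs]; right; linarith
  have b0 : ∫⁻ t in E0, A (ψ t) * B (t - ψ t) ≤ 8 * (As * Bs) := by
    calc _ ≤ ∫⁻ t in E0, A (ψ t - 0 * t) * Bs := by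
          refine lintegral_mono fun t => ?_
          simp only [zero_mul, sub_zero]
          gcongr; exact hBs _
      _ = (∫⁻ t in E0, A (ψ t - 0 * t)) * Bs :=
          lintegral_mul_const _ (hA.comp (by fun_prop))
      _ ≤ (2 * (4 : ℕ) * ∫⁻ s, A s) * Bs := by
          gcongr
          refine oneD_cov (fun t => ψ t - 0 * t) E0 hE0m ?_ ?_ 4 ?_ A hA
          · intro t ht; have := hdiff t ht.1; fun_prop
          · intro t ht; exact ht.2
          · intro v
            exact fibre_card r Q L e S M σ 0 v hσ E0 (fun t ht => ⟨(hE t ht.1).1, (hE t ht.1).2, ht.2⟩)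
      _ ≤ (2 * (4 : ℕ) * As) * Bs := by gcongr
      _ = _ := by push_cast; ring
  have b1 : ∫⁻ t in E1, A (ψ t) * B (t - ψ t) ≤ 8 * (As * Bs) := by
    calc _ ≤ ∫⁻ t in E1, As * B (-(ψ t - 1 * t)) := by
          refine lintegral_mono fun t => ?_
          simp only [one_mul, neg_sub]
          gcongr; exact hAs _
      _ = As * (∫⁻ t in E1, B (-(ψ t - 1 * t))) :=
          lintegral_const_mul _ (hB.comp (by fun_prop))
      _ ≤ As * (2 * (4 : ℕ) * ∫⁻ s, B (-s)) := by
          gcongr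
          refine oneD_cov (fun t => ψ t - 1 * t) E1 hE1m ?_ ?_ 4 ?_ (fun s => B (-s)) (by fun_prop)
          · intro t ht; have := hdiff t ht.1; fun_prop
          · intro t ht; exact ht.2
          · intro v
            exact fibre_card r Q L e S M σ 1 v hσ E1 (fun t ht => ⟨(hE t ht.1).1, (hE t ht.1).2, ht.2⟩)
      _ ≤ As * (2 * (4 : ℕ) * Bs) := by
          rw [lintegral_neg_eq_self]
          gcongr
      _ = _ := by push_cast; ring
  calc _ ≤ _ := lintegral_mono_set hcov
    _ ≤ _ := lintegral_union_le _ _ _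
    _ ≤ _ := add_le_add b0 b1
    _ = _ := by ring



/-- Energy density in direction `i`. -/
def den {n : ℕ} (i : Fin n) (g : En n → ℂ) (ξ : En n) : ℝ≥0∞ :=
  ENNReal.ofReal (‖g ξ‖ ^ 2 + ‖fderiv ℝ g ξ (EuclideanSpace.single i 1)‖ ^ 2)

lemma line_sup (φ φ' : ℝ → ℂ) (hφ : ∀ t, HasDerivAt φ (φ' t) t) (hc : Continuous φ')
    (h0 : Tendsto φ atBot (nhds 0)) (t : ℝ) :
    ENNReal.ofReal (‖φ t‖ ^ 2) ≤ ∫⁻ s, ENNReal.ofReal (‖φ s‖ ^ 2 + ‖φ' s‖ ^ 2) := by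
  have hφc : Continuous φ := continuous_iff_continuousAt.mpr fun t => (hφ t).continuousAt
  have hder : ∀ s, HasDerivAt (fun s => ‖φ s‖ ^ 2) (2 * ⟪φ s, φ' s⟫) s := by
    intro s
    exact (hφ s).norm_sq
  have hcd : Continuous fun s => 2 * ⟪φ s, φ' s⟫ := by fun_prop
  have hstep : ∀ s, s ≤ t → ENNReal.ofReal (‖φ t‖ ^ 2 - ‖φ s‖ ^ 2) ≤
      ∫⁻ s, ENNReal.ofReal (‖φ s‖ ^ 2 + ‖φ' s‖ ^ 2) := by
    intro s hst
    have hftc := intervalIntegral.integral_eq_sub_of_hasDerivAt (a := s) (b := t)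
      (fun x _ => hder x) (hcd.intervalIntegrable _ _)
    rw [← hftc, intervalIntegral.integral_of_le hst]
    have h2 : ENNReal.ofReal (∫ x in Ioc s t, 2 * ⟪φ x, φ' x⟫) ≤
        ∫⁻ x in Ioc s t, ENNReal.ofReal (2 * ⟪φ x, φ' x⟫) := by
      have hi : Integrable (fun x => 2 * ⟪φ x, φ' x⟫) (volume.restrict (Ioc s t)) :=
        (hcd.intervalIntegrable s t).1
      have : ∫ x in Ioc s t, 2 * ⟪φ x, φ' x⟫ ≤ ∫ x in Ioc s t, max (2 * ⟪φ x, φ' x⟫) 0 :=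
        integral_mono hi hi.pos_part (fun x => le_max_left _ _)
      refine (ENNReal.ofReal_le_ofReal this).trans ?_
      rw [ofReal_integral_eq_lintegral_ofReal hi.pos_part (ae_of_all _ fun x => le_max_right _ _)]
      refine lintegral_mono fun x => ?_
      rcases le_total (2 * ⟪φ x, φ' x⟫) 0 with h | h
      · simp [max_eq_right h]
      · rw [max_eq_left h]
    refine h2.trans ((setLIntegral_le_lintegral _ _).trans (lintegral_mono fun x => ?_))
    apply ENNReal.ofReal_le_ofReal
    have := real_inner_le_norm (φ x) (φ' x)
    nlinarith [sq_nonneg (‖φ x‖ - ‖φ' x‖)]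
  have hlim : Tendsto (fun s => ENNReal.ofReal (‖φ t‖ ^ 2 - ‖φ s‖ ^ 2)) atBot
      (nhds (ENNReal.ofReal (‖φ t‖ ^ 2 - 0))) := by
    apply (ENNReal.continuous_ofReal.tendsto _).comp
    apply Tendsto.sub tendsto_const_nhds
    have := (h0.norm).pow 2
    simpa using this
  rw [sub_zero] at hlim
  exact le_of_tendsto hlim ((eventually_le_atBot t).mono fun s hs => hstep s hs)

lemma hasDerivAt_ins {m : ℕ} (i : Fin (m + 1)) (x : Fin m → ℝ) (t : ℝ) :
    HasDerivAt (fun t => ins i t x) (EuclideanSpace.single i (1 : ℝ)) t := by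
  have h : (fun t => ins i t x) = fun t => ins i 0 x + t • EuclideanSpace.single i (1 : ℝ) := by
    funext t
    ext j
    rcases Fin.eq_self_or_eq_succAbove i j with h | ⟨l, rfl⟩
    · subst h; simp
    · simp
  rw [h]
  have := ((hasDerivAt_id t).smul_const (EuclideanSpace.single i (1 : ℝ))).const_add (ins i 0 x)
  simpa using this

lemma schwartz_line_sup {m : ℕ} (i : Fin (m + 1)) (g : 𝓢(En (m + 1), ℂ)) (x : Fin m → ℝ) (t : ℝ) :
    ENNReal.ofReal (‖g (ins i t x)‖ ^ 2) ≤ ∫⁻ s, den i g (ins i s x) := by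
  have hins : Continuous fun t => ins i t x :=
    (continuous_ins i).comp (Continuous.prodMk_left x)
  refine line_sup (fun t => g (ins i t x))
    (fun t => fderiv ℝ g (ins i t x) (EuclideanSpace.single i 1)) ?_ ?_ ?_ t
  · intro t
    exact (g.differentiableAt.hasFDerivAt).comp_hasDerivAt t (hasDerivAt_ins i x t)
  · have : Continuous (fderiv ℝ g) := (g.smooth 1).continuous_fderiv (by norm_num)
    exact (this.comp hins).clm_apply continuous_const
  · refine g.tendsto_cocompact.comp ?_
    refine tendsto_cocompact_of_tendsto_dist_comp_atTop (0 : En (m + 1)) ?_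
    refine tendsto_atTop_mono (f := fun t : ℝ => |t|) ?_ tendsto_abs_atBot_atTop
    intro s
    rw [dist_zero_right]
    have := PiLp.norm_apply_le (ins i s x) i
    simpa using this

lemma measurable_den {n : ℕ} (i : Fin n) (g : 𝓢(En n, ℂ)) : Measurable (den i g) := by
  unfold den
  have h : Continuous (fderiv ℝ g) := (g.smooth 1).continuous_fderiv (by norm_num)
  have h2 := g.continuous
  have : Continuous fun ξ => ‖g ξ‖ ^ 2 + ‖fderiv ℝ g ξ (EuclideanSpace.single i 1)‖ ^ 2 := by
    have := h.clm_apply (continuous_const (y := (EuclideanSpace.single i (1:ℝ))))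
    fun_prop
  exact (ENNReal.continuous_ofReal.comp this).measurable

lemma schwartz_sq_int {n : ℕ} (g : 𝓢(En n, ℂ)) : Integrable (fun ξ => ‖g ξ‖ ^ 2) := by
  have := (g.memLp 2 volume).integrable_norm_pow (by norm_num)
  simpa using this

lemma jap_rpow_eq {n : ℕ} (β : ℝ) (x : En n) : jap x ^ β = (1 + ‖x‖ ^ 2) ^ (β / 2) := by
  unfold jap
  rw [Real.sqrt_eq_rpow, ← Real.rpow_mul (by positivity)]
  congr 1; ring

lemma jap_temp {n : ℕ} (β : ℝ) : (fun x : En n => jap x ^ β).HasTemperateGrowth := by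
  simp_rw [jap_rpow_eq]
  exact Function.hasTemperateGrowth_one_add_norm_sq_rpow _ _

lemma sob_energy {n : ℕ} (β : ℝ) (f : 𝓢(En n, ℂ)) :
    ∃ g : 𝓢(En n, ℂ), (∀ ξ, g ξ = (jap ξ ^ β : ℝ) • 𝓕 (f : En n → ℂ) ξ) ∧
      ∀ i, ∫⁻ ξ, den i g ξ ≤ ENNReal.ofReal ((1 + 4 * π ^ 2) * sobNorm β 1 f ^ 2) := by
  set g : 𝓢(En n, ℂ) := SchwartzMap.smulLeftCLM ℂ (fun x : En n => jap x ^ β) (𝓕 f) with hg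
  have hgx : ∀ ξ, g ξ = (jap ξ ^ β : ℝ) • 𝓕 (f : En n → ℂ) ξ := by
    intro ξ
    rw [hg, SchwartzMap.smulLeftCLM_apply_apply (jap_temp β)]
    rfl
  refine ⟨g, hgx, ?_⟩
  intro i
  set h : 𝓢(En n, ℂ) := 𝓕⁻ g with hh
  have hFh : 𝓕 h = g := by rw [hh]; simp
  have hcoe : ∀ x, 𝓕⁻ (fun ξ => (jap ξ ^ β : ℝ) • 𝓕 (f : En n → ℂ) ξ) x = h x := by
    intro x
    have : (fun ξ => (jap ξ ^ β : ℝ) • 𝓕 (f : En n → ℂ) ξ) = (g : En n → ℂ) := by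
      funext ξ; rw [hgx]
    rw [this, hh, SchwartzMap.fourierInv_coe]
  have hI0 : 0 ≤ ∫ x, jap x ^ (2 * (1:ℝ)) * ‖h x‖ ^ 2 :=
    integral_nonneg fun x => mul_nonneg (Real.rpow_nonneg (jap_pos x).le _) (sq_nonneg _)
  have hsob : sobNorm β 1 f ^ 2 = ∫ x, jap x ^ 2 * ‖h x‖ ^ 2 := by
    unfold sobNorm
    simp_rw [hcoe]
    rw [← Real.rpow_natCast, ← Real.rpow_mul hI0]
    norm_num
  have h_integ : Integrable fun x => jap x ^ 2 * ‖h x‖ ^ 2 := by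
    have := schwartz_sq_int (SchwartzMap.smulLeftCLM ℂ (fun x : En n => jap x ^ (1:ℝ)) h)
    refine this.congr (ae_of_all _ fun x => ?_)
    simp only
    rw [SchwartzMap.smulLeftCLM_apply_apply (jap_temp 1), norm_smul, mul_pow, Real.rpow_one,
      Real.norm_of_nonneg (jap_pos x).le]
  have hin : (inner ℝ · (EuclideanSpace.single i (1:ℝ)) : En n → ℝ).HasTemperateGrowth := by fun_prop
  set w : 𝓢(En n, ℂ) := -(2 * π * Complex.I) •
    SchwartzMap.smulLeftCLM ℂ (inner ℝ · (EuclideanSpace.single i (1:ℝ))) h with hw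
  have hder : ∀ ξ, fderiv ℝ g ξ (EuclideanSpace.single i 1) = 𝓕 w ξ := by
    intro ξ
    rw [hw, ← SchwartzMap.lineDerivOp_fourier_eq, hFh, SchwartzMap.lineDerivOp_apply_eq_fderiv]
  have hwn : ∀ x, ‖w x‖ ^ 2 ≤ 4 * π ^ 2 * (jap x ^ 2 * ‖h x‖ ^ 2) := by
    intro x
    have e : w x = -(2 * π * Complex.I) • ((inner ℝ x (EuclideanSpace.single i (1:ℝ)) : ℝ) • h x) := by
      rw [hw, smul_apply, SchwartzMap.smulLeftCLM_apply_apply hin]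
    have e2 : (inner ℝ x (EuclideanSpace.single i (1:ℝ)) : ℝ) = x i := by
      rw [real_inner_comm, EuclideanSpace.inner_single_left]; simp
    rw [e, e2, norm_smul, norm_smul, mul_pow, mul_pow]
    have e3 : ‖-(2 * (π:ℂ) * Complex.I)‖ = 2 * π := by
      simp [abs_of_pos Real.pi_pos]
    rw [e3]
    have := coord_le_jap x i
    rw [Real.norm_eq_abs]
    have : |x i| ^ 2 ≤ jap x ^ 2 := by gcongr
    have h3 : 0 ≤ ‖h x‖ ^ 2 := sq_nonneg _
    have h4 : 0 ≤ π ^ 2 := sq_nonneg _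
    nlinarith [mul_le_mul_of_nonneg_left (mul_le_mul_of_nonneg_right this h3) h4]
  have hhn : ∀ x, ‖h x‖ ^ 2 ≤ jap x ^ 2 * ‖h x‖ ^ 2 := by
    intro x
    have := one_le_jap x
    have : 1 ≤ jap x ^ 2 := by nlinarith
    nlinarith [sq_nonneg ‖h x‖]
  have i1 : ∫ ξ, ‖g ξ‖ ^ 2 = ∫ x, ‖h x‖ ^ 2 := by
    rw [← SchwartzMap.integral_norm_sq_fourier h, hFh]
  have i2 : ∫ ξ, ‖(𝓕 w) ξ‖ ^ 2 = ∫ x, ‖w x‖ ^ 2 := SchwartzMap.integral_norm_sq_fourier w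
  unfold den
  simp_rw [hder]
  have hadd : Integrable fun ξ => ‖g ξ‖ ^ 2 + ‖(𝓕 w) ξ‖ ^ 2 :=
    (schwartz_sq_int g).add (schwartz_sq_int (𝓕 w))
  rw [← ofReal_integral_eq_lintegral_ofReal hadd
    (ae_of_all _ fun x => by positivity)]
  apply ENNReal.ofReal_le_ofReal
  rw [integral_add (schwartz_sq_int g) (schwartz_sq_int (𝓕 w)), i1, i2, hsob, add_mul, one_mul]
  refine add_le_add (integral_mono (schwartz_sq_int h) h_integ hhn) ?_
  rw [← integral_const_mul]
  exact integral_mono (schwartz_sq_int w) (h_integ.const_mul _) hwn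



lemma kval_ins {m : ℕ} (θ : En (m + 1)) (i : Fin (m + 1)) (t : ℝ) (z : Fin m → ℝ) :
    kval θ (ins i t z) = kk (∑ l, z l ^ 2) (∑ l, z l * θ (i.succAbove l)) (θ i) t := by
  unfold kval kk
  rw [real_inner_comm, inner_ins, norm_sq_ins]

lemma gD_ins {m : ℕ} (θ : En (m + 1)) (hθ : ‖θ‖ = 1) (r : ℝ) (i : Fin (m + 1)) (t : ℝ)
    (z x : Fin m → ℝ) :
    gD (-(kval θ (ins i t z) • θ)) (r * kval θ (ins i t z)) i x =
      dd r (∑ l, z l ^ 2) (∑ l, z l * θ (i.succAbove l)) (θ i) (∑ l, x l ^ 2)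
        (∑ l, x l * θ (i.succAbove l)) t := by
  have h1 := norm_sq_drp i θ
  rw [hθ] at h1
  unfold gD dd
  rw [← kval_ins]
  set k := kval θ (ins i t z)
  have : ∑ l, (x l - (-(k • θ)) (i.succAbove l)) ^ 2 = ∑ l, x l ^ 2 +
      2 * k * (∑ l, x l * θ (i.succAbove l)) + k ^ 2 * ∑ l, θ (i.succAbove l) ^ 2 := by
    rw [Finset.mul_sum, Finset.mul_sum, ← Finset.sum_add_distrib, ← Finset.sum_add_distrib]
    refine Finset.sum_congr rfl fun l _ => ?_
    simp
    ring
  rw [this]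
  linear_combination k ^ 2 * h1

lemma gH_ins {m : ℕ} (θ : En (m + 1)) (hθ : ‖θ‖ = 1) (r : ℝ) (i : Fin (m + 1)) (σ t : ℝ)
    (z x : Fin m → ℝ) :
    gH (-(kval θ (ins i t z) • θ)) (r * kval θ (ins i t z)) i σ x =
      pp r (∑ l, z l ^ 2) (∑ l, z l * θ (i.succAbove l)) (θ i) (∑ l, x l ^ 2)
        (∑ l, x l * θ (i.succAbove l)) σ t := by
  unfold gH pp
  rw [gD_ins θ hθ, ← kval_ins]
  simp

lemma kval_pos {n : ℕ} (θ η : En n) (h : ⟪η, θ⟫ < 0) : 0 < kval θ η := by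
  unfold kval
  rw [real_inner_comm]
  have : η ≠ 0 := by rintro rfl; simp at h
  have : 0 < ‖η‖ := norm_pos_iff.mpr this
  apply div_pos_of_neg_of_neg _ h
  have := pow_pos this 2
  linarith

lemma measurable_kval {n : ℕ} (θ : En n) : Measurable (kval θ) := by
  unfold kval
  fun_prop

/-- The set of admissible pairs. -/
def TT {m : ℕ} (θ : En (m + 1)) (r : ℝ) (i : Fin (m + 1)) : Set (En (m + 1) × (Fin m → ℝ)) :=
  {p | ⟪p.1, θ⟫ < 0 ∧ p.2 ∈ gU (-(kval θ p.1 • θ)) (r * kval θ p.1) i}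

/-- The sphere point. -/
def sp {m : ℕ} (θ : En (m + 1)) (r : ℝ) (i : Fin (m + 1)) (σ : ℝ) (p : En (m + 1) × (Fin m → ℝ)) :
    En (m + 1) := ins i (gH (-(kval θ p.1 • θ)) (r * kval θ p.1) i σ p.2) p.2

lemma measurable_gD_pair {m : ℕ} (θ : En (m + 1)) (r : ℝ) (i : Fin (m + 1)) :
    Measurable fun p : En (m + 1) × (Fin m → ℝ) => gD (-(kval θ p.1 • θ)) (r * kval θ p.1) i p.2 := by
  have hk : Measurable fun p : En (m + 1) × (Fin m → ℝ) => kval θ p.1 :=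
    (measurable_kval θ).comp measurable_fst
  unfold gD
  simp only [PiLp.neg_apply, PiLp.smul_apply, smul_eq_mul]
  fun_prop

lemma measurableSet_TT {m : ℕ} (θ : En (m + 1)) (r : ℝ) (i : Fin (m + 1)) :
    MeasurableSet (TT θ r i) := by
  have hk : Measurable fun p : En (m + 1) × (Fin m → ℝ) => kval θ p.1 :=
    (measurable_kval θ).comp measurable_fst
  have h1 : MeasurableSet {p : En (m + 1) × (Fin m → ℝ) | ⟪p.1, θ⟫ < 0} :=
    measurableSet_lt (by fun_prop) measurable_const
  have h2 : MeasurableSet {p : En (m + 1) × (Fin m → ℝ) | (r * kval θ p.1 / (m + 1)) ^ 2 ≤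
      gD (-(kval θ p.1 • θ)) (r * kval θ p.1) i p.2} :=
    measurableSet_le (by fun_prop) (measurable_gD_pair θ r i)
  exact h1.inter h2

lemma measurable_sp {m : ℕ} (θ : En (m + 1)) (r : ℝ) (i : Fin (m + 1)) (σ : ℝ) :
    Measurable (sp θ r i σ) := by
  have hk : Measurable fun p : En (m + 1) × (Fin m → ℝ) => kval θ p.1 :=
    (measurable_kval θ).comp measurable_fst
  have := measurable_gD_pair θ r i
  refine measurable_ins i ?_ measurable_snd
  unfold gH
  simp only [PiLp.neg_apply, PiLp.smul_apply, smul_eq_mul]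
  fun_prop

lemma den_ge {n : ℕ} (i : Fin n) (g : En n → ℂ) (ξ : En n) : ENNReal.ofReal (‖g ξ‖ ^ 2) ≤ den i g ξ := by
  unfold den
  apply ENNReal.ofReal_le_ofReal
  nlinarith [sq_nonneg ‖fderiv ℝ g ξ (EuclideanSpace.single i 1)‖]

lemma patch_star {m : ℕ} (θ : En (m + 1)) (hθ : ‖θ‖ = 1) (r : ℝ) (hr : 0 < r)
    (g₁ g₂ : 𝓢(En (m + 1), ℂ)) (i : Fin (m + 1)) (σ : ℝ) (hσ : σ ^ 2 = 1) :
    ∫⁻ η, ∫⁻ x, (TT θ r i).indicator (fun p => ENNReal.ofReal (‖g₁ (sp θ r i σ p)‖ ^ 2) *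
      ENNReal.ofReal (‖g₂ (p.1 - sp θ r i σ p)‖ ^ 2)) (η, x) ≤
      16 * ((∫⁻ ξ, den i g₁ ξ) * ∫⁻ ξ, den i g₂ ξ) := by
  set Φ := (TT θ r i).indicator (fun p => ENNReal.ofReal (‖g₁ (sp θ r i σ p)‖ ^ 2) *
      ENNReal.ofReal (‖g₂ (p.1 - sp θ r i σ p)‖ ^ 2)) with hΦ
  have hA : Measurable fun ξ => ENNReal.ofReal (‖g₁ ξ‖ ^ 2) := by
    have := g₁.continuous.measurable; fun_prop
  have hB : Measurable fun ξ => ENNReal.ofReal (‖g₂ ξ‖ ^ 2) := by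
    have := g₂.continuous.measurable; fun_prop
  have hsp := measurable_sp θ r i σ
  have hΦm : Measurable Φ := by
    refine Measurable.indicator ?_ (measurableSet_TT θ r i)
    exact (hA.comp hsp).mul (hB.comp (measurable_fst.sub hsp))
  rw [lintegral_ins i (fun η => ∫⁻ x, Φ (η, x)) hΦm.lintegral_prod_right']
  set As : (Fin m → ℝ) → ℝ≥0∞ := fun x => ∫⁻ s, den i g₁ (ins i s x) with hAs
  set Bs : (Fin m → ℝ) → ℝ≥0∞ := fun x => ∫⁻ s, den i g₂ (ins i s x) with hBs
  have hm : ∀ g : 𝓢(En (m + 1), ℂ), Measurable fun x : Fin m → ℝ => ∫⁻ s, den i g (ins i s x) := by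
    intro g
    have : Measurable fun p : (Fin m → ℝ) × ℝ => den i g (ins i p.2 p.1) :=
      (measurable_den i g).comp (measurable_ins i measurable_snd measurable_fst)
    exact this.lintegral_prod_right'
  have hAsm : Measurable As := hm g₁
  have hBsm : Measurable Bs := hm g₂
  have inner_bd : ∀ z x : Fin m → ℝ, ∫⁻ t, Φ (ins i t z, x) ≤ 16 * (As x * Bs (z - x)) := by
    intro z x
    set E : Set ℝ := {t | (ins i t z, x) ∈ TT θ r i} with hE
    have hpair : Measurable fun t : ℝ => (ins i t z, x) :=
      (measurable_ins i measurable_id measurable_const).prodMk measurable_const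
    have hEm : MeasurableSet E := hpair (measurableSet_TT θ r i)
    set ψ := pp r (∑ l, z l ^ 2) (∑ l, z l * θ (i.succAbove l)) (θ i) (∑ l, x l ^ 2)
        (∑ l, x l * θ (i.succAbove l)) σ with hψ
    have e1 : ∫⁻ t, Φ (ins i t z, x) = ∫⁻ t in E, ENNReal.ofReal (‖g₁ (ins i (ψ t) x)‖ ^ 2) *
        ENNReal.ofReal (‖g₂ (ins i (t - ψ t) (z - x))‖ ^ 2) := by
      rw [← lintegral_indicator hEm]
      refine lintegral_congr fun t => ?_
      have e2 : sp θ r i σ (ins i t z, x) = ins i (ψ t) x := by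
        unfold sp
        simp only
        rw [gH_ins θ hθ]
      by_cases h : t ∈ E
      · rw [indicator_of_mem h, hΦ, indicator_of_mem (by exact h), e2, ins_sub]
      · rw [indicator_of_notMem h, hΦ, indicator_of_notMem (by exact h)]
    rw [e1]
    refine line_core r _ _ _ _ _ σ hσ E hEm ?_ (fun s => ENNReal.ofReal (‖g₁ (ins i s x)‖ ^ 2))
      (fun s => ENNReal.ofReal (‖g₂ (ins i s (z - x))‖ ^ 2))
      (hA.comp (measurable_ins i measurable_id measurable_const))
      (hB.comp (measurable_ins i measurable_id measurable_const)) (As x) (Bs (z - x)) ?_ ?_ ?_ ?_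
    · intro t ht
      obtain ⟨h1, h2⟩ := ht
      have h1' : ⟪ins i t z, θ⟫ < 0 := h1
      have h2' : (r * kval θ (ins i t z) / (m + 1)) ^ 2 ≤
        gD (-(kval θ (ins i t z) • θ)) (r * kval θ (ins i t z)) i x := h2
      rw [gD_ins θ hθ] at h2'
      have hk := kval_pos _ _ h1'
      rw [inner_ins] at h1'
      exact ⟨h1', lt_of_lt_of_le (by positivity) h2'⟩
    · intro t; exact schwartz_line_sup i g₁ x t
    · intro t; exact schwartz_line_sup i g₂ (z - x) t
    · exact lintegral_mono fun s => den_ge i g₁ _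
    · exact lintegral_mono fun s => den_ge i g₂ _
  calc ∫⁻ z, ∫⁻ t, ∫⁻ x, Φ (ins i t z, x) = ∫⁻ z, ∫⁻ x, ∫⁻ t, Φ (ins i t z, x) := by
        refine lintegral_congr fun z => ?_
        rw [lintegral_lintegral_swap]
        have : Measurable fun p : ℝ × (Fin m → ℝ) => (ins i p.1 z, p.2) :=
          (measurable_ins i measurable_fst measurable_const).prodMk measurable_snd
        exact (hΦm.comp this).aemeasurable
    _ ≤ ∫⁻ z, ∫⁻ x, 16 * (As x * Bs (z - x)) :=
        lintegral_mono fun z => lintegral_mono fun x => inner_bd z x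
    _ = ∫⁻ x, ∫⁻ z, 16 * (As x * Bs (z - x)) := by
        rw [lintegral_lintegral_swap]
        exact (measurable_const.mul ((hAsm.comp measurable_snd).mul
          (hBsm.comp (measurable_fst.sub measurable_snd)))).aemeasurable
    _ = ∫⁻ x, (16 * ∫⁻ z, Bs z) * As x := by
        refine lintegral_congr fun x => ?_
        have hms : Measurable fun z : Fin m → ℝ => Bs (z - x) := hBsm.comp (measurable_id.sub_const x)
        rw [lintegral_const_mul _ (hms.const_mul _), lintegral_const_mul _ hms,
          lintegral_sub_right_eq_self (fun z => Bs z) x]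
        ring
    _ = _ := by
        rw [lintegral_const_mul _ hAsm, lintegral_ins i _ (measurable_den i g₁),
          lintegral_ins i _ (measurable_den i g₂)]
        ring

lemma star_est {m : ℕ} (θ : En (m + 1)) (hθ : ‖θ‖ = 1) (r : ℝ) (hr : 0 < r)
    (g₁ g₂ : 𝓢(En (m + 1), ℂ)) (D₁ D₂ : ℝ≥0∞) (hD₁ : ∀ i, ∫⁻ ξ, den i g₁ ξ ≤ D₁)
    (hD₂ : ∀ i, ∫⁻ ξ, den i g₂ ξ ≤ D₂) :
    ∫⁻ η in {η | ⟪η, θ⟫ < 0}, ∫⁻ ξ in ewald θ η r, ENNReal.ofReal (‖g₁ ξ‖ ^ 2) *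
        ENNReal.ofReal (‖g₂ (η - ξ)‖ ^ 2) ∂μH[(m : ℝ)] ≤
      ENNReal.ofReal (((m + 2 : ℝ) ^ 2) ^ (m : ℝ)) *
        ((((Finset.univ : Finset (Fin (m + 1))) ×ˢ ({1, -1} : Finset ℝ)).card : ℝ≥0∞) *
          (16 * (D₁ * D₂))) := by
  set S := (Finset.univ : Finset (Fin (m + 1))) ×ˢ ({1, -1} : Finset ℝ) with hS
  have hA : Measurable fun ξ => ENNReal.ofReal (‖g₁ ξ‖ ^ 2) := by
    have := g₁.continuous.measurable; fun_prop
  have hB : Measurable fun ξ => ENNReal.ofReal (‖g₂ ξ‖ ^ 2) := by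
    have := g₂.continuous.measurable; fun_prop
  set Φ : Fin (m + 1) × ℝ → En (m + 1) × (Fin m → ℝ) → ℝ≥0∞ := fun q =>
    (TT θ r q.1).indicator (fun p => ENNReal.ofReal (‖g₁ (sp θ r q.1 q.2 p)‖ ^ 2) *
      ENNReal.ofReal (‖g₂ (p.1 - sp θ r q.1 q.2 p)‖ ^ 2)) with hΦ
  have hΦm : ∀ q, Measurable (Φ q) := by
    intro q
    refine Measurable.indicator ?_ (measurableSet_TT θ r q.1)
    have hsp := measurable_sp θ r q.1 q.2
    exact (hA.comp hsp).mul (hB.comp (measurable_fst.sub hsp))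
  have hpm : MeasurableSet {η : En (m + 1) | ⟪η, θ⟫ < 0} :=
    measurableSet_lt (by fun_prop) measurable_const
  calc _ ≤ ∫⁻ η in {η | ⟪η, θ⟫ < 0}, ENNReal.ofReal (((m + 2 : ℝ) ^ 2) ^ (m : ℝ)) *
        ∑ q ∈ S, ∫⁻ x, Φ q (η, x) := by
        refine setLIntegral_mono' hpm ?_
        intro η hη
        have hη' : ⟪η, θ⟫ < 0 := hη
        have hk := kval_pos θ η hη'
        refine (sphere_lintegral_le (-(kval θ η • θ)) (r * kval θ η) (by positivity)
          (fun ξ => ENNReal.ofReal (‖g₁ ξ‖ ^ 2) * ENNReal.ofReal (‖g₂ (η - ξ)‖ ^ 2))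
          (hA.mul (hB.comp (measurable_const.sub measurable_id)))).trans ?_
        refine mul_le_mul_right (Finset.sum_le_sum fun q hq => ?_) _
        have hUm : MeasurableSet (gU (-(kval θ η • θ)) (r * kval θ η) q.1) :=
          measurableSet_le measurable_const (measurable_gD _ _ q.1).measurable
        rw [← lintegral_indicator hUm]
        refine lintegral_mono fun x => ?_
        by_cases hx : x ∈ gU (-(kval θ η • θ)) (r * kval θ η) q.1
        · rw [indicator_of_mem hx, hΦ]
          simp only
          rw [indicator_of_mem (by exact ⟨hη', hx⟩)]
          rfl
        · rw [indicator_of_notMem hx]; exact zero_le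
    _ ≤ ∫⁻ η, ENNReal.ofReal (((m + 2 : ℝ) ^ 2) ^ (m : ℝ)) * ∑ q ∈ S, ∫⁻ x, Φ q (η, x) :=
        setLIntegral_le_lintegral _ _
    _ = ENNReal.ofReal (((m + 2 : ℝ) ^ 2) ^ (m : ℝ)) * ∑ q ∈ S, ∫⁻ η, ∫⁻ x, Φ q (η, x) := by
        rw [lintegral_const_mul _ (Finset.measurable_sum _ fun q _ => (hΦm q).lintegral_prod_right'),
          lintegral_finsetSum _ fun q _ => (hΦm q).lintegral_prod_right']
    _ ≤ ENNReal.ofReal (((m + 2 : ℝ) ^ 2) ^ (m : ℝ)) * ∑ q ∈ S, 16 * (D₁ * D₂) := by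
        gcongr with q hq
        refine (patch_star θ hθ r hr g₁ g₂ q.1 q.2 ?_).trans ?_
        · have h2 := (Finset.mem_product.mp hq).2
          simp only [Finset.mem_insert, Finset.mem_singleton] at h2
          rcases h2 with h | h <;> rw [h] <;> norm_num
        · gcongr
          · exact hD₁ _
          · exact hD₂ _
    _ = _ := by rw [Finset.sum_const, nsmul_eq_mul]



lemma ofReal_integral_le_lint {X : Type*} [MeasurableSpace X] (μ : Measure X) (f : X → ℝ)
    (hf : ∀ x, 0 ≤ f x) : ENNReal.ofReal (∫ x, f x ∂μ) ≤ ∫⁻ x, ENNReal.ofReal (f x) ∂μ := by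
  by_cases h : Integrable f μ
  · rw [ofReal_integral_eq_lintegral_ofReal h (ae_of_all _ hf)]
  · rw [integral_undef h]; simp

lemma cs_sq {X : Type*} [MeasurableSpace X] (μ : Measure X) (u v : X → ℝ≥0∞)
    (hu : Measurable u) (hv : Measurable v) :
    (∫⁻ x, u x * v x ∂μ) ^ 2 ≤ (∫⁻ x, u x ^ 2 ∂μ) * ∫⁻ x, v x ^ 2 ∂μ := by
  have h := ENNReal.lintegral_mul_le_Lp_mul_Lq μ Real.HolderConjugate.two_two hu.aemeasurable
    hv.aemeasurable
  have e : ∀ w : ℝ≥0∞, (w ^ (1 / 2 : ℝ)) ^ 2 = w := by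
    intro w
    rw [← ENNReal.rpow_natCast, ← ENNReal.rpow_mul]; norm_num
  have h2 := pow_le_pow_left₀ zero_le h 2
  rw [mul_pow, e, e] at h2
  have e3 : ∀ w : ℝ≥0∞, w ^ (2 : ℝ) = w ^ 2 := fun w => by
    rw [← ENNReal.rpow_natCast]; norm_num
  simp_rw [e3] at h2
  exact h2

lemma jap_sub_comm {n : ℕ} (x y : En n) : jap (x - y) = jap (y - x) := by
  unfold jap; rw [norm_sub_rev]

lemma peetre {n : ℕ} (η ξ : En n) (β b : ℝ) (hb : b ≤ β) (hβ : 0 ≤ β) :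
    jap ξ ^ (-(2 * β)) * jap (η - ξ) ^ (-(2 * β)) ≤
      4 ^ β * jap η ^ (-(2 * β)) * (jap (ξ - 0) ^ (-(2 * b)) + jap (ξ - η) ^ (-(2 * b))) := by
  rw [sub_zero, jap_sub_comm ξ η]
  have hsq : jap η ^ 2 ≤ 2 * jap ξ ^ 2 + 2 * jap (η - ξ) ^ 2 := by
    rw [jap_sq, jap_sq, jap_sq]
    have h : ‖η‖ ≤ ‖ξ‖ + ‖η - ξ‖ := by
      have := norm_add_le ξ (η - ξ); simpa using this
    nlinarith [sq_nonneg (‖ξ‖ - ‖η - ξ‖), norm_nonneg η, norm_nonneg ξ, norm_nonneg (η - ξ)]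
  have aux : ∀ X Y Z : ℝ, 1 ≤ X → 1 ≤ Y → 1 ≤ Z → Z ≤ 2 * Y →
      X ^ (-(2 * β)) * Y ^ (-(2 * β)) ≤ 4 ^ β * Z ^ (-(2 * β)) * X ^ (-(2 * b)) := by
    intro X Y Z hX hY hZ h
    have h1 : Y ^ (-(2 * β)) ≤ 4 ^ β * Z ^ (-(2 * β)) := by
      have : Y ^ (-(2 * β)) ≤ (Z / 2) ^ (-(2 * β)) :=
        Real.rpow_le_rpow_of_nonpos (by linarith) (by linarith) (by linarith)
      refine this.trans (le_of_eq ?_)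
      rw [Real.div_rpow (by linarith) (by norm_num), Real.rpow_neg (by norm_num : (0:ℝ) ≤ 2),
        Real.rpow_mul (by norm_num : (0:ℝ) ≤ 2)]
      norm_num
      ring
    have h2 : X ^ (-(2 * β)) ≤ X ^ (-(2 * b)) :=
      Real.rpow_le_rpow_of_exponent_le hX (by linarith)
    have p1 : 0 ≤ X ^ (-(2 * b)) := Real.rpow_nonneg (by linarith) _
    have p2 : 0 ≤ Y ^ (-(2 * β)) := Real.rpow_nonneg (by linarith) _
    calc _ ≤ X ^ (-(2 * b)) * (4 ^ β * Z ^ (-(2 * β))) := mul_le_mul h2 h1 p2 p1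
      _ = _ := by ring
  have q1 : 0 ≤ jap ξ ^ (-(2 * b)) := Real.rpow_nonneg (jap_pos _).le _
  have q2 : 0 ≤ jap (η - ξ) ^ (-(2 * b)) := Real.rpow_nonneg (jap_pos _).le _
  have q3 : 0 ≤ 4 ^ β * jap η ^ (-(2 * β)) :=
    mul_nonneg (Real.rpow_nonneg (by norm_num) _) (Real.rpow_nonneg (jap_pos _).le _)
  have j1 := one_le_jap ξ
  have j2 := one_le_jap (η - ξ)
  have j3 := one_le_jap η
  rw [mul_add]
  rcases le_total (jap ξ) (jap (η - ξ)) with h | h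
  · have : jap η ≤ 2 * jap (η - ξ) := by
      apply le_of_sq_le_sq _ (by linarith); nlinarith
    have := aux _ _ _ j1 j2 j3 this
    nlinarith [mul_nonneg q3 q2]
  · have : jap η ≤ 2 * jap ξ := by
      apply le_of_sq_le_sq _ (by linarith); nlinarith
    have := aux _ _ _ j2 j1 j3 this
    nlinarith [mul_nonneg q3 q1]

lemma jap_le_kval {n : ℕ} (θ η : En n) (hθ : ‖θ‖ = 1) (h : ⟪η, θ⟫ < 0) (hη : 1 ≤ ‖η‖) :
    jap η ≤ 2 * kval θ η := by
  have h1 : ‖η‖ ≤ kval θ η := by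
    unfold kval
    rw [real_inner_comm, neg_div, ← div_neg, le_div_iff₀ (by linarith)]
    have := abs_real_inner_le_norm η θ
    rw [hθ, mul_one, abs_of_neg h] at this
    nlinarith [norm_nonneg η]
  have h2 : jap η ≤ 2 * ‖η‖ := by
    unfold jap
    rw [Real.sqrt_le_left (by positivity)]
    nlinarith
  linarith

lemma weights (J k r α β ε M b Cp : ℝ) (hJ : 1 ≤ J) (hk : 0 < k) (hJk : J ≤ 2 * k) (hr : 0 < r)
    (hCp : 0 < Cp)
    (hs : 0 ≤ 2 - 2 * ε - M + 2 * b) (hα : 2 * α ≤ 2 * β + (2 - 2 * ε - M + 2 * b)) :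
    J ^ (2 * α) * (k ^ ε * k⁻¹) ^ 2 * (4 ^ β * J ^ (-(2 * β)) * (2 * (Cp * (r * k) ^ (M - 2 * b)))) ≤
      2 ^ (2 - 2 * ε - M + 2 * b) * 4 ^ β * 2 * Cp * r ^ (M - 2 * b) := by
  set s := 2 - 2 * ε - M + 2 * b with hsdef
  have hJ0 : 0 < J := by linarith
  have e1 : J ^ (2 * α) * J ^ (-(2 * β)) ≤ 2 ^ s * k ^ s := by
    rw [← Real.rpow_add hJ0, ← Real.mul_rpow (by norm_num) hk.le]
    calc _ ≤ J ^ s := Real.rpow_le_rpow_of_exponent_le hJ (by linarith)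
      _ ≤ _ := Real.rpow_le_rpow hJ0.le hJk hs
  have e2 : (k ^ ε * k⁻¹) ^ 2 = k ^ (2 * ε - 2) := by
    rw [← Real.rpow_neg_one k, ← Real.rpow_add hk, ← Real.rpow_natCast, ← Real.rpow_mul hk.le]
    congr 1; push_cast; ring
  have e3 : k ^ s * (k ^ (2 * ε - 2) * k ^ (M - 2 * b)) = 1 := by
    rw [← Real.rpow_add hk, ← Real.rpow_add hk, show s + (2 * ε - 2 + (M - 2 * b)) = 0 by rw [hsdef]; ring,
      Real.rpow_zero]
  rw [e2, Real.mul_rpow hr.le hk.le]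
  have p : 0 ≤ 4 ^ β * 2 * Cp * r ^ (M - 2 * b) * (k ^ (2 * ε - 2) * k ^ (M - 2 * b)) := by positivity
  calc _ = (J ^ (2 * α) * J ^ (-(2 * β))) * (4 ^ β * 2 * Cp * r ^ (M - 2 * b) * (k ^ (2 * ε - 2) * k ^ (M - 2 * b))) := by ring
    _ ≤ (2 ^ s * k ^ s) * (4 ^ β * 2 * Cp * r ^ (M - 2 * b) * (k ^ (2 * ε - 2) * k ^ (M - 2 * b))) :=
        mul_le_mul_of_nonneg_right e1 p
    _ = 2 ^ s * 4 ^ β * 2 * Cp * r ^ (M - 2 * b) * (k ^ s * (k ^ (2 * ε - 2) * k ^ (M - 2 * b))) := by ring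
    _ = _ := by rw [e3, mul_one]

lemma pointwise {m : ℕ} (β ε α b Cp : ℝ) (hβ : 0 ≤ β) (hb : b ≤ β) (hCp : 0 < Cp)
    (hpot : ∀ (c p : En (m + 1)) (R : ℝ), 0 < R →
      ∫⁻ ξ in sphere c R, ENNReal.ofReal (jap (ξ - p) ^ (-(2 * b))) ∂μH[(m : ℝ)] ≤
        ENNReal.ofReal (Cp * R ^ ((m : ℝ) - 2 * b)))
    (hs : 0 ≤ 2 - 2 * ε - (m : ℝ) + 2 * b) (hα : 2 * α ≤ 2 * β + (2 - 2 * ε - (m : ℝ) + 2 * b))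
    (θ : En (m + 1)) (hθ : ‖θ‖ = 1) (r : ℝ) (hr : 0 < r) (f₁ f₂ : En (m + 1) → ℂ)
    (g₁ g₂ : 𝓢(En (m + 1), ℂ)) (hg₁ : ∀ ξ, g₁ ξ = (jap ξ ^ β : ℝ) • f₁ ξ)
    (hg₂ : ∀ ξ, g₂ ξ = (jap ξ ^ β : ℝ) • f₂ ξ) (η : En (m + 1)) (hη : ⟪η, θ⟫ < 0) (hη1 : 1 ≤ ‖η‖)
    (c : ℝ) (hc : c ∈ Icc (0:ℝ) 1) :
    ENNReal.ofReal (jap η ^ (2 * α) * ‖kval θ η ^ ε * c * ((kval θ η)⁻¹ *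
      ∫ ξ in ewald θ η r, ‖f₁ ξ‖ * ‖f₂ (η - ξ)‖ ∂μH[(m : ℝ)])‖ ^ 2) ≤
    ENNReal.ofReal (2 ^ (2 - 2 * ε - (m : ℝ) + 2 * b) * 4 ^ β * 2 * Cp * r ^ ((m : ℝ) - 2 * b)) *
      ∫⁻ ξ in ewald θ η r, ENNReal.ofReal (‖g₁ ξ‖ ^ 2) *
        ENNReal.ofReal (‖g₂ (η - ξ)‖ ^ 2) ∂μH[(m : ℝ)] := by
  set k := kval θ η with hkdef
  have hk : 0 < k := kval_pos θ η hη
  set I := ∫ ξ in ewald θ η r, ‖f₁ ξ‖ * ‖f₂ (η - ξ)‖ ∂μH[(m : ℝ)] with hI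
  have hI0 : 0 ≤ I := integral_nonneg fun ξ => by positivity
  have hj : ∀ ξ : En (m + 1), 0 < jap ξ ^ β := fun ξ => Real.rpow_pos_of_pos (jap_pos ξ) _
  have hjn : ∀ ξ : En (m + 1), jap ξ ^ (-β) * jap ξ ^ β = 1 := fun ξ => by
    rw [← Real.rpow_add (jap_pos ξ)]; simp
  have hf₁ : ∀ ξ, ‖f₁ ξ‖ = jap ξ ^ (-β) * ‖g₁ ξ‖ := fun ξ => by
    rw [hg₁, norm_smul, Real.norm_of_nonneg (hj ξ).le, ← mul_assoc, hjn, one_mul]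
  have hf₂ : ∀ ξ, ‖f₂ ξ‖ = jap ξ ^ (-β) * ‖g₂ ξ‖ := fun ξ => by
    rw [hg₂, norm_smul, Real.norm_of_nonneg (hj ξ).le, ← mul_assoc, hjn, one_mul]
  set u : En (m + 1) → ℝ≥0∞ := fun ξ => ENNReal.ofReal (jap ξ ^ (-β) * jap (η - ξ) ^ (-β)) with hu
  set v : En (m + 1) → ℝ≥0∞ := fun ξ => ENNReal.ofReal (‖g₁ ξ‖ * ‖g₂ (η - ξ)‖) with hv
  have hjm : Measurable (jap (n := m + 1)) := continuous_jap.measurable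
  have hjm2 : Measurable fun ξ : En (m + 1) => jap (η - ξ) := hjm.comp (by fun_prop)
  have hum : Measurable u := by fun_prop
  have hvm : Measurable v := by
    have h1 := g₁.continuous
    have h2 := g₂.continuous
    have h3 : Continuous fun ξ => ‖g₁ ξ‖ * ‖g₂ (η - ξ)‖ := by fun_prop
    exact (ENNReal.continuous_ofReal.comp h3).measurable
  have hjpos : ∀ ξ : En (m + 1), 0 ≤ jap ξ ^ (-β) := fun ξ => Real.rpow_nonneg (jap_pos ξ).le _
  set V := ∫⁻ ξ in ewald θ η r, ENNReal.ofReal (‖g₁ ξ‖ ^ 2) *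
        ENNReal.ofReal (‖g₂ (η - ξ)‖ ^ 2) ∂μH[(m : ℝ)] with hV
  have hI2 : ENNReal.ofReal I ^ 2 ≤ (∫⁻ ξ in ewald θ η r, u ξ ^ 2 ∂μH[(m : ℝ)]) * V := by
    have h1 : ENNReal.ofReal I ≤ ∫⁻ ξ in ewald θ η r, u ξ * v ξ ∂μH[(m : ℝ)] := by
      refine (ofReal_integral_le_lint _ _ fun ξ => by positivity).trans (le_of_eq ?_)
      refine lintegral_congr fun ξ => ?_
      simp only [hu, hv]
      rw [← ENNReal.ofReal_mul (mul_nonneg (hjpos _) (hjpos _)), hf₁, hf₂]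
      congr 1; ring
    refine (pow_le_pow_left₀ zero_le h1 2).trans ((cs_sq _ u v hum hvm).trans (le_of_eq ?_))
    congr 1
    refine lintegral_congr fun ξ => ?_
    simp only [hv]
    rw [← ENNReal.ofReal_pow (by positivity), mul_pow, ENNReal.ofReal_mul (by positivity)]
  have hU : ∫⁻ ξ in ewald θ η r, u ξ ^ 2 ∂μH[(m : ℝ)] ≤
      ENNReal.ofReal (4 ^ β * jap η ^ (-(2 * β)) * (2 * (Cp * (r * k) ^ ((m : ℝ) - 2 * b)))) := by
    have q3 : 0 ≤ 4 ^ β * jap η ^ (-(2 * β)) :=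
      mul_nonneg (Real.rpow_nonneg (by norm_num) _) (Real.rpow_nonneg (jap_pos _).le _)
    have q1 : ∀ w : En (m + 1), 0 ≤ jap w ^ (-(2 * b)) := fun w => Real.rpow_nonneg (jap_pos _).le _
    have hrk : 0 < r * k := by positivity
    have hms : ∀ p : En (m + 1), Measurable fun ξ : En (m + 1) => ENNReal.ofReal (jap (ξ - p) ^ (-(2 * b))) := by
      intro p
      have : Measurable fun ξ : En (m + 1) => jap (ξ - p) := hjm.comp (by fun_prop)
      fun_prop
    calc _ ≤ ∫⁻ ξ in ewald θ η r, ENNReal.ofReal (4 ^ β * jap η ^ (-(2 * β))) *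
          (ENNReal.ofReal (jap (ξ - 0) ^ (-(2 * b))) + ENNReal.ofReal (jap (ξ - η) ^ (-(2 * b)))) ∂μH[(m : ℝ)] := by
          refine lintegral_mono fun ξ => ?_
          simp only [hu]
          rw [← ENNReal.ofReal_pow (mul_nonneg (hjpos _) (hjpos _)), ← ENNReal.ofReal_add (q1 _) (q1 _),
            ← ENNReal.ofReal_mul q3]
          apply ENNReal.ofReal_le_ofReal
          refine le_trans (le_of_eq ?_) (peetre η ξ β b hb hβ)
          have : ∀ w : En (m + 1), (jap w ^ (-β)) ^ 2 = jap w ^ (-(2 * β)) := fun w => by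
            rw [← Real.rpow_natCast, ← Real.rpow_mul (jap_pos w).le]; congr 1; push_cast; ring
          rw [mul_pow, this, this]
      _ = ENNReal.ofReal (4 ^ β * jap η ^ (-(2 * β))) *
          ((∫⁻ ξ in ewald θ η r, ENNReal.ofReal (jap (ξ - 0) ^ (-(2 * b))) ∂μH[(m : ℝ)]) +
          ∫⁻ ξ in ewald θ η r, ENNReal.ofReal (jap (ξ - η) ^ (-(2 * b))) ∂μH[(m : ℝ)]) := by
          rw [lintegral_const_mul' _ _ ENNReal.ofReal_ne_top, lintegral_add_left (hms 0)]
      _ ≤ ENNReal.ofReal (4 ^ β * jap η ^ (-(2 * β))) *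
          (ENNReal.ofReal (Cp * (r * k) ^ ((m : ℝ) - 2 * b)) + ENNReal.ofReal (Cp * (r * k) ^ ((m : ℝ) - 2 * b))) :=
          mul_le_mul_right (add_le_add (hpot _ _ _ hrk) (hpot _ _ _ hrk)) _
      _ = _ := by
          rw [← ENNReal.ofReal_add (by positivity) (by positivity), ← ENNReal.ofReal_mul q3]
          congr 1; ring
  have hJ := one_le_jap η
  have hJ0 : 0 ≤ jap η ^ (2 * α) := Real.rpow_nonneg (jap_pos _).le _
  calc _ ≤ ENNReal.ofReal (jap η ^ (2 * α) * (k ^ ε * k⁻¹) ^ 2 * I ^ 2) := by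
        apply ENNReal.ofReal_le_ofReal
        rw [mul_assoc (jap η ^ (2 * α))]
        refine mul_le_mul_of_nonneg_left ?_ hJ0
        rw [← mul_pow, Real.norm_eq_abs, sq_abs]
        have hc0 := hc.1
        have hc1 := hc.2
        have hke : 0 ≤ k ^ ε := Real.rpow_nonneg hk.le _
        have hA : 0 ≤ k ^ ε * k⁻¹ * I := by positivity
        apply pow_le_pow_left₀ (by positivity)
        nlinarith
    _ = ENNReal.ofReal (jap η ^ (2 * α) * (k ^ ε * k⁻¹) ^ 2) * ENNReal.ofReal I ^ 2 := by
        rw [ENNReal.ofReal_mul (by positivity), ENNReal.ofReal_pow hI0]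
    _ ≤ ENNReal.ofReal (jap η ^ (2 * α) * (k ^ ε * k⁻¹) ^ 2) *
        (ENNReal.ofReal (4 ^ β * jap η ^ (-(2 * β)) * (2 * (Cp * (r * k) ^ ((m : ℝ) - 2 * b)))) * V) :=
        mul_le_mul_right (hI2.trans (mul_le_mul_left hU V)) _
    _ = ENNReal.ofReal (jap η ^ (2 * α) * (k ^ ε * k⁻¹) ^ 2 *
        (4 ^ β * jap η ^ (-(2 * β)) * (2 * (Cp * (r * k) ^ ((m : ℝ) - 2 * b))))) * V := by
        rw [← mul_assoc, ← ENNReal.ofReal_mul (by positivity)]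
    _ ≤ _ := by
        refine mul_le_mul_left (ENNReal.ofReal_le_ofReal ?_) V
        exact weights (jap η) k r α β ε m b Cp hJ hk (jap_le_kval θ η hθ hη hη1) hr hCp hs hα

lemma main_aux {m : ℕ} (hm : 1 ≤ m) (β ε C₀ α b : ℝ) (hβ : 0 ≤ β) (hC₀ : 1 < C₀)
    (χ : En (m + 1) → ℝ) (hχ : IsCutoff C₀ χ) (hb0 : 0 ≤ b) (hb : b ≤ β) (hbm : 2 * b < m)
    (hs : 0 ≤ 2 - 2 * ε - (m : ℝ) + 2 * b) (hα : 2 * α ≤ 2 * β + (2 - 2 * ε - (m : ℝ) + 2 * b)) :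
    ∃ C : ℝ, 0 < C ∧ 
      ∀ θ : En (m + 1), ‖θ‖ = 1 → ∀ r : ℝ, 0 < r → ∀ f₁ f₂ : 𝓢(En (m + 1), ℂ),
        L2w α (fun η => if ⟪η, θ⟫ < 0 then
            kval θ η ^ ε * χ η * Kop θ r (𝓕 ⇑f₁) (𝓕 ⇑f₂) η else 0)
          ≤ C * (1 + r) ^ (((m : ℝ) - 2 * b) / 2) * sobNorm β 1 ⇑f₁ * sobNorm β 1 ⇑f₂ := by
  obtain ⟨Cp, hCp, hpot⟩ := sphere_pot hm b hb0 hbm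
  set A : ℝ := 2 ^ (2 - 2 * ε - (m : ℝ) + 2 * b) * 4 ^ β * 2 * Cp with hA
  have hA0 : 0 < A := by positivity
  set N : ℝ := ((((Finset.univ : Finset (Fin (m + 1))) ×ˢ ({1, -1} : Finset ℝ)).card : ℕ) : ℝ) with hN
  set B : ℝ := ((m + 2 : ℝ) ^ 2) ^ (m : ℝ) * ((N + 1) * 16) with hB
  have hN0 : 0 ≤ N := by positivity
  have hB0 : 0 < B := by positivity
  have hsn : ∀ f : 𝓢(En (m + 1), ℂ), 0 ≤ sobNorm β 1 f := by
    intro f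
    unfold sobNorm
    exact Real.rpow_nonneg (integral_nonneg fun x =>
      mul_nonneg (Real.rpow_nonneg (jap_pos x).le _) (sq_nonneg _)) _
  refine ⟨Real.sqrt (A * B) * (1 + 4 * π ^ 2), by positivity, ?_⟩
  intro θ hθ r hr f₁ f₂
  obtain ⟨g₁, hg₁, hd₁⟩ := sob_energy β f₁
  obtain ⟨g₂, hg₂, hd₂⟩ := sob_energy β f₂
  set s₁ := sobNorm β 1 f₁ with hs₁
  set s₂ := sobNorm β 1 f₂ with hs₂
  have p₁ : 0 ≤ s₁ := hsn f₁
  have p₂ : 0 ≤ s₂ := hsn f₂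
  set F : En (m + 1) → ℝ := fun η => if ⟪η, θ⟫ < 0 then
            kval θ η ^ ε * χ η * Kop θ r (𝓕 ⇑f₁) (𝓕 ⇑f₂) η else 0 with hF
  have hnn : ∀ η, 0 ≤ jap η ^ (2 * α) * ‖F η‖ ^ 2 := fun η =>
    mul_nonneg (Real.rpow_nonneg (jap_pos _).le _) (sq_nonneg _)
  have hpm : MeasurableSet {η : En (m + 1) | ⟪η, θ⟫ < 0} :=
    measurableSet_lt (by fun_prop) measurable_const
  set V : En (m + 1) → ℝ≥0∞ := fun η => ∫⁻ ξ in ewald θ η r, ENNReal.ofReal (‖g₁ ξ‖ ^ 2) *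
        ENNReal.ofReal (‖g₂ (η - ξ)‖ ^ 2) ∂μH[(m : ℝ)] with hV
  have h_integ : ENNReal.ofReal (∫ η, jap η ^ (2 * α) * ‖F η‖ ^ 2) ≤
      ENNReal.ofReal (A * r ^ ((m : ℝ) - 2 * b) * (B * ((1 + 4 * π ^ 2) * s₁ ^ 2 * ((1 + 4 * π ^ 2) * s₂ ^ 2)))) := by
    calc _ ≤ ∫⁻ η, ENNReal.ofReal (jap η ^ (2 * α) * ‖F η‖ ^ 2) := ofReal_integral_le_lint _ _ hnn
      _ ≤ ∫⁻ η, {η : En (m + 1) | ⟪η, θ⟫ < 0}.indicator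
            (fun η => ENNReal.ofReal (A * r ^ ((m : ℝ) - 2 * b)) * V η) η := by
          refine lintegral_mono fun η => ?_
          by_cases hη : ⟪η, θ⟫ < 0
          · rw [indicator_of_mem (by exact hη)]
            by_cases h1 : 1 ≤ ‖η‖
            · have h := pointwise β ε α b Cp hβ hb hCp hpot hs hα θ hθ r hr (𝓕 ⇑f₁) (𝓕 ⇑f₂) g₁ g₂
                hg₁ hg₂ η hη h1 (χ η) (hχ.mem_Icc η)
              have e : F η = kval θ η ^ ε * χ η * ((kval θ η)⁻¹ *
                  ∫ ξ in ewald θ η r, ‖(𝓕 ⇑f₁) ξ‖ * ‖(𝓕 ⇑f₂) (η - ξ)‖ ∂μH[(m : ℝ)]) := by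
                rw [hF]
                simp only [Kop, if_pos hη]
                have : ((m + 1 : ℕ) : ℝ) - 1 = (m : ℝ) := by push_cast; ring
                rw [this]
              rw [e]
              exact h
            · have : F η = 0 := by
                rw [hF]
                simp only
                rw [hχ.eq_zero η (by linarith [not_le.mp h1])]
                simp
              simp [this]
          · have : F η = 0 := by
              rw [hF]; simp only [if_neg hη]
            simp [this]
      _ = ENNReal.ofReal (A * r ^ ((m : ℝ) - 2 * b)) * ∫⁻ η in {η : En (m + 1) | ⟪η, θ⟫ < 0}, V η := by
          rw [lintegral_indicator hpm, lintegral_const_mul' _ _ ENNReal.ofReal_ne_top]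
      _ ≤ ENNReal.ofReal (A * r ^ ((m : ℝ) - 2 * b)) *
          ENNReal.ofReal (B * ((1 + 4 * π ^ 2) * s₁ ^ 2 * ((1 + 4 * π ^ 2) * s₂ ^ 2))) := by
          refine mul_le_mul_right ((star_est θ hθ r hr g₁ g₂ _ _ hd₁ hd₂).trans ?_) _
          rw [← ENNReal.ofReal_natCast, ← ENNReal.ofReal_mul (by positivity),
            show (16 : ℝ≥0∞) = ENNReal.ofReal 16 by norm_num,
            ← ENNReal.ofReal_mul (by norm_num), ← ENNReal.ofReal_mul (by positivity),
            ← ENNReal.ofReal_mul (by positivity)]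
          apply ENNReal.ofReal_le_ofReal
          rw [← hN, hB]
          set Y := (1 + 4 * π ^ 2) * s₁ ^ 2 * ((1 + 4 * π ^ 2) * s₂ ^ 2) with hY
          have hY0 : 0 ≤ Y := by positivity
          rw [mul_assoc]
          refine mul_le_mul_of_nonneg_left ?_ (by positivity)
          nlinarith
      _ = _ := by rw [← ENNReal.ofReal_mul (by positivity)]
  have hreal : ∫ η, jap η ^ (2 * α) * ‖F η‖ ^ 2 ≤
      A * r ^ ((m : ℝ) - 2 * b) * (B * ((1 + 4 * π ^ 2) * s₁ ^ 2 * ((1 + 4 * π ^ 2) * s₂ ^ 2))) :=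
    (ENNReal.ofReal_le_ofReal_iff (by positivity)).mp h_integ
  have hlam : (((1 + r) ^ (((m : ℝ) - 2 * b) / 2)) ^ 2 : ℝ) = (1 + r) ^ ((m : ℝ) - 2 * b) := by
    rw [← Real.rpow_natCast, ← Real.rpow_mul (by linarith)]
    congr 1; push_cast; ring
  have hr1 : r ^ ((m : ℝ) - 2 * b) ≤ (1 + r) ^ ((m : ℝ) - 2 * b) :=
    Real.rpow_le_rpow hr.le (by linarith) (by linarith)
  unfold L2w
  rw [← Real.sqrt_eq_rpow]
  rw [Real.sqrt_le_left (by positivity)]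
  refine hreal.trans ?_
  have e : (√(A * B) * (1 + 4 * π ^ 2) * (1 + r) ^ (((m : ℝ) - 2 * b) / 2) * s₁ * s₂) ^ 2 =
      A * (1 + r) ^ ((m : ℝ) - 2 * b) * (B * ((1 + 4 * π ^ 2) * s₁ ^ 2 * ((1 + 4 * π ^ 2) * s₂ ^ 2))) := by
    rw [← hlam, mul_pow, mul_pow, mul_pow, mul_pow, Real.sq_sqrt (by positivity)]
    ring
  rw [e]
  gcongr

theorem main_est (n : ℕ) (hn : 2 ≤ n) (β ε C₀ α : ℝ)
    (hβ : 0 ≤ β) (hε0 : 0 ≤ ε) (hε1 : ε < 1) (hC₀ : 1 < C₀)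
    (χ : En n → ℝ) (hχ : IsCutoff C₀ χ)
    (hα : (((n : ℝ) - 3) / 2 + ε < β ∧ β < ((n : ℝ) - 1) / 2 ∧
            α ≤ 2 * β - ((n : ℝ) - 3) / 2 - ε) ∨
          (((n : ℝ) - 1) / 2 ≤ β ∧ α < β + 1 - ε)) :
    ∃ C : ℝ, 0 < C ∧ ∃ lam : ℝ, 0 < lam ∧ lam < 1 ∧
      ∀ θ : En n, ‖θ‖ = 1 → ∀ r : ℝ, 0 < r → ∀ f₁ f₂ : 𝓢(En n, ℂ),
        L2w α (fun η => if ⟪η, θ⟫ < 0 then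
            kval θ η ^ ε * χ η * Kop θ r (𝓕 ⇑f₁) (𝓕 ⇑f₂) η else 0)
          ≤ C * (1 + r) ^ lam * sobNorm β 1 ⇑f₁ * sobNorm β 1 ⇑f₂ := by
  obtain ⟨m, rfl⟩ : ∃ m, n = m + 1 := ⟨n - 1, by omega⟩
  have hm : 1 ≤ m := by omega
  have hm1 : (1 : ℝ) ≤ m := by exact_mod_cast hm
  push_cast at hα
  have hb : ∃ b : ℝ, 0 ≤ b ∧ b ≤ β ∧ 2 * b < m ∧ 0 ≤ 2 - 2 * ε - (m : ℝ) + 2 * b ∧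
      2 * α ≤ 2 * β + (2 - 2 * ε - (m : ℝ) + 2 * b) ∧ (m : ℝ) - 2 * b < 2 := by
    rcases hα with ⟨h1, h2, h3⟩ | ⟨h1, h2⟩
    · exact ⟨β, hβ, le_rfl, by linarith, by linarith, by linarith, by linarith⟩
    · set δ := min (β + 1 - ε - α) (min (1 - ε) (1 / 2)) / 2 with hδ
      have hmin : 0 < min (β + 1 - ε - α) (min (1 - ε) (1 / 2)) := by
        refine lt_min (by linarith) (lt_min (by linarith) (by norm_num))
      have d1 := min_le_left (β + 1 - ε - α) (min (1 - ε) (1 / 2))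
      have d2 := (min_le_right (β + 1 - ε - α) (min (1 - ε) (1 / 2))).trans (min_le_left _ _)
      have d3 := (min_le_right (β + 1 - ε - α) (min (1 - ε) (1 / 2))).trans (min_le_right _ _)
      exact ⟨m / 2 - δ, by linarith, by linarith, by linarith, by linarith, by linarith, by linarith⟩
  obtain ⟨b, hb0, hbβ, hbm, hs, hα', hlt⟩ := hb
  obtain ⟨C, hC, h⟩ := main_aux hm β ε C₀ α b hβ hC₀ χ hχ hb0 hbβ hbm hs hα'
  exact ⟨C, hC, ((m : ℝ) - 2 * b) / 2, by linarith, by linarith, h⟩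

/-- Estimate for the bilinear operator `K_r` over Ewald spheres (Lemma 3.2):
`‖k^ε χ K_r(𝓕f₁,𝓕f₂)‖_{L²_α} ≤ C (1+r)^λ ‖f₁‖_{W^{β,2}_1} ‖f₂‖_{W^{β,2}_1}`. -/
theorem Kop_weighted_L2_estimate (n : ℕ) (hn : 2 ≤ n) (β ε C₀ α : ℝ)
    (hβ : 0 ≤ β) (hε0 : 0 ≤ ε) (hε1 : ε < 1) (hC₀ : 1 < C₀)
    (χ : En n → ℝ) (hχ : IsCutoff C₀ χ)
    (hα : (((n : ℝ) - 3) / 2 + ε < β ∧ β < ((n : ℝ) - 1) / 2 ∧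
            α ≤ 2 * β - ((n : ℝ) - 3) / 2 - ε) ∨
          (((n : ℝ) - 1) / 2 ≤ β ∧ α < β + 1 - ε)) :
    ∃ C : ℝ, 0 < C ∧ ∃ lam : ℝ, 0 < lam ∧ lam < 1 ∧
      ∀ θ : En n, ‖θ‖ = 1 → ∀ r : ℝ, 0 < r → ∀ f₁ f₂ : 𝓢(En n, ℂ),
        L2w α (fun η => if ⟪η, θ⟫ < 0 then
            kval θ η ^ ε * χ η * Kop θ r (𝓕 ⇑f₁) (𝓕 ⇑f₂) η else 0)
          ≤ C * (1 + r) ^ lam * sobNorm β 1 ⇑f₁ * sobNorm β 1 ⇑f₂ := by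
  exact main_est n hn β ε C₀ α hβ hε0 hε1 hC₀ χ hχ hα

end
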